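/- arXiv:2605.30586 — 4 statements merged into one kernel-verified Lean document; each statement's English description precedes it below -/
import Mathlib

section
/- Let d ≥ 1 be an integer, s ∈ (0,1), and let N be an integer with N > d + 1. Then there exists a constant δ = δ(d,s,N) > 0 such that for every x = (x₁,…,x_N) ∈ Ω^{(N)} one has Σ_{1≤i<j<k≤N} R_s(x_i,x_j,x_k) ≥ δ · Σ_{1≤i<j≤N} 1/|x_i−x_j|^{2s}. -/
open MeasureTheory Real

noncomputable section

/-- `ℝ^d` as a Euclidean space. -/
abbrev Euc (d : ℕ) := EuclideanSpace ℝ (Fin d)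

/-- The non-negative defect term `R_s(x₁,x₂,x₃)`. -/
def Rdef {d : ℕ} (s : ℝ) (x₁ x₂ x₃ : Euc d) : ℝ :=
  ((‖x₁ - x₂‖^(2*s) - ‖x₁ - x₃‖^(2*s))^2 + (‖x₁ - x₃‖^(2*s) - ‖x₂ - x₃‖^(2*s))^2
      + (‖x₂ - x₃‖^(2*s) - ‖x₁ - x₂‖^(2*s))^2)
    / (2 * ‖x₁ - x₂‖^(2*s) * ‖x₁ - x₃‖^(2*s) * ‖x₂ - x₃‖^(2*s))

lemma Rdef_nonneg {d : ℕ} (s : ℝ) (x y z : Euc d) : 0 ≤ Rdef s x y z := by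
  unfold Rdef
  positivity

lemma Rdef_swap_left {d : ℕ} (s : ℝ) (x y z : Euc d) : Rdef s x y z = Rdef s y x z := by
  unfold Rdef
  rw [norm_sub_rev y x]
  congr 1 <;> ring

lemma Rdef_swap_right {d : ℕ} (s : ℝ) (x y z : Euc d) : Rdef s x y z = Rdef s x z y := by
  unfold Rdef
  rw [norm_sub_rev z y]
  congr 1 <;> ring

/-- If one side of a triple exceeds another side `u` by a factor `p`, the defect is at least
a constant multiple of `1 / u`. -/
lemma le_defect_of_mul_le {p u v w : ℝ} (hp : 1 < p) (hu : 0 < u) (hw : 0 < w)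
    (h : p * u ≤ v) :
    (1 - 1 / p) ^ 2 / (2 * u) ≤
      ((u - v) ^ 2 + (v - w) ^ 2 + (w - u) ^ 2) / (2 * u * v * w) := by
  have hp0 : 0 < p := by linarith
  have hv : 0 < v := lt_of_lt_of_le (by positivity) h
  have key : ∀ m : ℝ, p * u ≤ m → 0 < m → (1 - 1 / p) ^ 2 * m ^ 2 ≤ (m - u) ^ 2 := by
    intro m hm hm0
    rw [← mul_pow]
    have h1 : u ≤ m / p := by rw [le_div_iff₀ hp0]; linarith
    have h2 : 1 / p ≤ 1 := by rw [div_le_one hp0]; exact hp.le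
    have h3 : (1 - 1 / p) * m = m - m / p := by ring
    apply pow_le_pow_left₀
    · exact mul_nonneg (by linarith) hm0.le
    · linarith
  rw [div_le_div_iff₀ (by positivity) (by positivity)]
  have hk : 0 ≤ (1 - 1 / p) ^ 2 := sq_nonneg _
  have main : (1 - 1 / p) ^ 2 * (v * w) ≤ (u - v) ^ 2 + (v - w) ^ 2 + (w - u) ^ 2 := by
    rcases le_total w v with hwv | hwv
    · have h1 := key v h hv
      have h2 : (1 - 1 / p) ^ 2 * (v * w) ≤ (1 - 1 / p) ^ 2 * v ^ 2 :=
        mul_le_mul_of_nonneg_left (by nlinarith) hk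
      nlinarith [sq_nonneg (v - w), sq_nonneg (w - u)]
    · have h1 := key w (h.trans hwv) hw
      have h2 : (1 - 1 / p) ^ 2 * (v * w) ≤ (1 - 1 / p) ^ 2 * w ^ 2 :=
        mul_le_mul_of_nonneg_left (by nlinarith) hk
      nlinarith [sq_nonneg (v - w), sq_nonneg (u - v)]
  calc (1 - 1 / p) ^ 2 * (2 * u * v * w) = ((1 - 1 / p) ^ 2 * (v * w)) * (2 * u) := by ring
    _ ≤ _ := mul_le_mul_of_nonneg_right main (by positivity)

/-- The defect at a triple of distinct points, in any order, is bounded by the total defect. -/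
lemma Rdef_le_sum {d N : ℕ} (s : ℝ) (x : Fin N → Euc d) {i j k : Fin N}
    (hij : i ≠ j) (hik : i ≠ k) (hjk : j ≠ k) :
    Rdef s (x i) (x j) (x k) ≤ ∑ i : Fin N, ∑ j : Fin N, ∑ k : Fin N,
      if i < j ∧ j < k then Rdef s (x i) (x j) (x k) else 0 := by
  have hnn : ∀ a b c : Fin N,
      0 ≤ if a < b ∧ b < c then Rdef s (x a) (x b) (x c) else 0 := by
    intro a b c
    split_ifs
    exacts [Rdef_nonneg _ _ _ _, le_rfl]
  have ordered : ∀ a b c : Fin N, a < b → b < c →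
      Rdef s (x a) (x b) (x c) ≤ ∑ i : Fin N, ∑ j : Fin N, ∑ k : Fin N,
        if i < j ∧ j < k then Rdef s (x i) (x j) (x k) else 0 := by
    intro a b c hab hbc
    calc Rdef s (x a) (x b) (x c)
        = if a < b ∧ b < c then Rdef s (x a) (x b) (x c) else 0 := by simp [hab, hbc]
      _ ≤ ∑ k : Fin N, if a < b ∧ b < k then Rdef s (x a) (x b) (x k) else 0 :=
          Finset.single_le_sum (f := fun k => if a < b ∧ b < k then Rdef s (x a) (x b) (x k) else 0)
            (fun k _ => hnn a b k) (Finset.mem_univ c)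
      _ ≤ ∑ j : Fin N, ∑ k : Fin N, if a < j ∧ j < k then Rdef s (x a) (x j) (x k) else 0 :=
          Finset.single_le_sum
            (f := fun j => ∑ k : Fin N, if a < j ∧ j < k then Rdef s (x a) (x j) (x k) else 0)
            (fun j _ => Finset.sum_nonneg fun k _ => hnn a j k) (Finset.mem_univ b)
      _ ≤ _ :=
          Finset.single_le_sum
            (f := fun i => ∑ j : Fin N, ∑ k : Fin N,
              if i < j ∧ j < k then Rdef s (x i) (x j) (x k) else 0)
            (fun i _ => Finset.sum_nonneg fun j _ => Finset.sum_nonneg fun k _ => hnn i j k)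
            (Finset.mem_univ a)
  rcases lt_or_gt_of_ne hij with h1 | h1 <;> rcases lt_or_gt_of_ne hjk with h2 | h2 <;>
    rcases lt_or_gt_of_ne hik with h3 | h3
  · exact ordered _ _ _ h1 h2
  · exact absurd (h1.trans h2) h3.not_gt
  · rw [Rdef_swap_right]
    exact ordered _ _ _ h3 h2
  · rw [Rdef_swap_right, Rdef_swap_left]
    exact ordered _ _ _ h3 h1
  · rw [Rdef_swap_left]
    exact ordered _ _ _ h1 h3
  · rw [Rdef_swap_left, Rdef_swap_right]
    exact ordered _ _ _ h2 h3
  · exact absurd (h2.trans h1) h3.not_gt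
  · rw [Rdef_swap_left, Rdef_swap_right, Rdef_swap_left]
    exact ordered _ _ _ h2 h1

/-- More than `d + 1` distinct points of `ℝ^d` cannot be almost equidistant. -/
lemma exists_dist_sq_gt {d N : ℕ} (hN : d + 1 < N) (x : Fin N → Euc d)
    (hx : Function.Injective x) {ρ : ℝ} (hρ : 0 < ρ)
    (hmin : ∀ i j, i ≠ j → ρ ≤ ‖x i - x j‖ ^ 2) :
    ∃ i j, i ≠ j ∧ (1 + 1 / (2 * N)) * ρ < ‖x i - x j‖ ^ 2 := by
  by_contra! hmax
  have hN0 : (0 : ℝ) < N := by exact_mod_cast (by omega : 0 < N)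
  obtain ⟨f, hf1, hf2, e, he, hfe⟩ :=
    Module.exists_nontrivial_relation_sum_zero_of_finrank_succ_lt_card (R := ℝ) (M := Euc d)
      (t := Finset.univ.map ⟨x, hx⟩) (by simpa using hN)
  simp only [Finset.sum_map, Function.Embedding.coeFn_mk] at hf1 hf2
  obtain ⟨m, -, rfl⟩ := Finset.mem_map.1 he
  have hzero := inner_sum_smul_sum_smul_of_sum_eq_zero (F := Euc d)
    (s₁ := Finset.univ) (s₂ := Finset.univ)
    (w₁ := fun i => f (x i)) x hf2 (w₂ := fun i => f (x i)) x hf2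
  rw [hf1, inner_zero_left] at hzero
  set S : ℝ := ∑ i, f (x i) ^ 2 with hS
  have hSpos : 0 < S :=
    Finset.sum_pos' (fun i _ => sq_nonneg _) ⟨m, Finset.mem_univ _, by
      simp only [Function.Embedding.coeFn_mk] at hfe; positivity⟩
  have hterm : ∀ i j, f (x i) * f (x j) * (‖x i - x j‖ * ‖x i - x j‖) ≤
      ρ * (f (x i) * f (x j)) + ρ / (4 * N) * (f (x i) ^ 2 + f (x j) ^ 2)
        - if i = j then ρ * f (x i) ^ 2 else 0 := by
    intro i j
    split_ifs with hij
    · subst hij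
      have : 0 ≤ ρ / (4 * N) * (f (x i) ^ 2 + f (x i) ^ 2) := by positivity
      simp only [sub_self, norm_zero, mul_zero]
      nlinarith
    · have h1 := hmin i j hij
      have h2 := hmax i j hij
      have h3 : ‖x i - x j‖ ^ 2 - ρ ≤ ρ / (2 * N) := by
        have : (1 + 1 / (2 * (N : ℝ))) * ρ = ρ + ρ / (2 * N) := by ring
        linarith
      have h4 : f (x i) * f (x j) * (‖x i - x j‖ ^ 2 - ρ) ≤
          (f (x i) ^ 2 + f (x j) ^ 2) / 2 * (ρ / (2 * N)) := by
        apply mul_le_mul _ h3 (by linarith) (by positivity)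
        nlinarith [sq_nonneg (f (x i) - f (x j))]
      have h5 : ρ / (4 * (N : ℝ)) * (f (x i) ^ 2 + f (x j) ^ 2) =
          (f (x i) ^ 2 + f (x j) ^ 2) / 2 * (ρ / (2 * N)) := by
        field_simp; ring
      rw [h5]
      nlinarith
  have hsum := Finset.sum_le_sum fun i (_ : i ∈ Finset.univ) =>
    Finset.sum_le_sum fun j (_ : j ∈ Finset.univ) => hterm i j
  have hrhs : ∑ i, ∑ j, (ρ * (f (x i) * f (x j)) + ρ / (4 * N) * (f (x i) ^ 2 + f (x j) ^ 2)
        - if i = j then ρ * f (x i) ^ 2 else 0) = -(ρ / 2) * S := by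
    simp only [Finset.sum_sub_distrib, Finset.sum_add_distrib, ← Finset.mul_sum, hf2,
      Finset.sum_ite_eq, Finset.mem_univ, if_true, Finset.sum_const, Finset.card_univ,
      Fintype.card_fin, nsmul_eq_mul, ← hS, mul_zero]
    field_simp
    ring
  rw [hrhs] at hsum
  have : 0 < ρ / 2 * S := by positivity
  linarith

/-- **Proposition 3.2**: for `N > d + 1` the total defect term uniformly dominates the
pairwise Coulomb-type potential. -/
theorem defect_dominates_Coulomb
    (d : ℕ) (hd : 1 ≤ d) (s : ℝ) (hs : s ∈ Set.Ioo (0:ℝ) 1)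
    (N : ℕ) (hN : d + 1 < N) :
    ∃ δ : ℝ, 0 < δ ∧
      ∀ x : Fin N → Euc d, (∀ i j, i ≠ j → x i ≠ x j) →
        δ * ∑ i : Fin N, ∑ j : Fin N,
            (if i < j then 1/‖x i - x j‖^(2*s) else 0)
          ≤ ∑ i : Fin N, ∑ j : Fin N, ∑ k : Fin N,
              if i < j ∧ j < k then Rdef s (x i) (x j) (x k) else 0 := by
  obtain ⟨hs0, -⟩ := hs
  have hN0 : (0 : ℝ) < N := by exact_mod_cast (by omega : 0 < N)
  set Q : ℝ := 1 + 1 / (2 * N) with hQ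
  have hQ1 : 1 < Q := by
    have : (0 : ℝ) < 1 / (2 * N) := by positivity
    linarith
  set p : ℝ := Q ^ (s / 2) with hp
  have hp1 : 1 < p := Real.one_lt_rpow hQ1 (by positivity)
  have hp0 : 0 < p := by linarith
  have hpp : p * p = Q ^ s := by
    rw [hp, ← Real.rpow_add (by linarith)]
    congr 1
    ring
  have hκ : 0 < (1 - 1 / p) ^ 2 := by
    have : 1 / p < 1 := by rw [div_lt_one hp0]; exact hp1
    exact pow_pos (by linarith) 2
  refine ⟨(1 - 1 / p) ^ 2 / (2 * p * N ^ 2), by positivity, fun x hx => ?_⟩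
  have hinj : Function.Injective x := fun i j h => by
    by_contra hij
    exact hx i j hij h
  have hnorm : ∀ i j, i ≠ j → 0 < ‖x i - x j‖ := fun i j hij =>
    norm_pos_iff.2 (sub_ne_zero.2 (hx i j hij))
  have hsq : ∀ i j, ‖x i - x j‖ ^ (2 * s) = (‖x i - x j‖ ^ 2) ^ s := fun i j => by
    rw [Real.rpow_mul (norm_nonneg _), Real.rpow_two]
  obtain ⟨⟨i, j⟩, hij, hmin⟩ := Finset.exists_min_image
    (Finset.univ.filter fun q : Fin N × Fin N => q.1 ≠ q.2) (fun q => ‖x q.1 - x q.2‖)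
    ⟨(⟨0, by omega⟩, ⟨1, by omega⟩), by simp⟩
  simp only [Finset.mem_filter, Finset.mem_univ, true_and, Prod.forall] at hij hmin
  set a : ℝ := ‖x i - x j‖ ^ (2 * s) with ha
  have ha0 : 0 < a := Real.rpow_pos_of_pos (hnorm i j hij) _
  have hpos : ∀ k l, k ≠ l → 0 < ‖x k - x l‖ ^ (2 * s) := fun k l hkl =>
    Real.rpow_pos_of_pos (hnorm k l hkl) _
  have hle : ∀ k l, k ≠ l → a ≤ ‖x k - x l‖ ^ (2 * s) := fun k l hkl =>
    Real.rpow_le_rpow (norm_nonneg _) (hmin k l hkl) (by positivity)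
  have hcoul : ∑ k : Fin N, ∑ l : Fin N, (if k < l then 1 / ‖x k - x l‖ ^ (2 * s) else 0)
      ≤ N ^ 2 * (1 / a) := by
    calc ∑ k : Fin N, ∑ l : Fin N, (if k < l then 1 / ‖x k - x l‖ ^ (2 * s) else 0)
        ≤ ∑ _k : Fin N, ∑ _l : Fin N, 1 / a := by
          refine Finset.sum_le_sum fun k _ => Finset.sum_le_sum fun l _ => ?_
          split_ifs with hkl
          · exact one_div_le_one_div_of_le ha0 (hle k l hkl.ne)
          · positivity
      _ = N ^ 2 * (1 / a) := by
          simp only [Finset.sum_const, Finset.card_univ, Fintype.card_fin, nsmul_eq_mul]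
          ring
  have hdefect : ∀ k l m, k ≠ l → k ≠ m → l ≠ m → ‖x k - x l‖ ^ (2 * s) ≤ p * a →
      p * ‖x k - x l‖ ^ (2 * s) ≤ ‖x k - x m‖ ^ (2 * s) →
      (1 - 1 / p) ^ 2 / (2 * (p * a)) ≤ ∑ i : Fin N, ∑ j : Fin N, ∑ k : Fin N,
        if i < j ∧ j < k then Rdef s (x i) (x j) (x k) else 0 := by
    intro k l m hkl hkm hlm h1 h2
    refine le_trans ?_ (Rdef_le_sum s x hkl hkm hlm)
    refine le_trans ?_ (le_defect_of_mul_le hp1 (hpos k l hkl) (hpos l m hlm) h2)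
    have := hpos k l hkl
    gcongr
  suffices h : (1 - 1 / p) ^ 2 / (2 * (p * a)) ≤ ∑ i : Fin N, ∑ j : Fin N, ∑ k : Fin N,
      if i < j ∧ j < k then Rdef s (x i) (x j) (x k) else 0 by
    refine le_trans ?_ h
    calc _ ≤ (1 - 1 / p) ^ 2 / (2 * p * N ^ 2) * (N ^ 2 * (1 / a)) :=
          mul_le_mul_of_nonneg_left hcoul (by positivity)
      _ = (1 - 1 / p) ^ 2 / (2 * (p * a)) := by
          generalize (1 - 1 / p) ^ 2 = κ
          field_simp
  have hpa : a ≤ p * a := by nlinarith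
  by_cases hfar : ∃ k, p * a < ‖x i - x k‖ ^ (2 * s)
  · obtain ⟨k, hk⟩ := hfar
    have hik : i ≠ k := by
      rintro rfl
      rw [sub_self, norm_zero, Real.zero_rpow (by positivity)] at hk
      linarith
    have hjk : j ≠ k := by
      rintro rfl
      exact absurd hk (not_lt.2 hpa)
    exact hdefect i j k hij hik hjk hpa hk.le
  · push Not at hfar
    obtain ⟨k, l, hkl, hgt⟩ := exists_dist_sq_gt hN x hinj (pow_pos (hnorm i j hij) 2)
      (fun k l hkl => pow_le_pow_left₀ (norm_nonneg _) (hmin k l hkl) 2)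
    have hlt : p * (p * a) < ‖x k - x l‖ ^ (2 * s) := by
      rw [← mul_assoc, hpp, ha, hsq, hsq, ← Real.mul_rpow (by linarith) (by positivity)]
      exact Real.rpow_lt_rpow (by positivity) hgt hs0
    have hbig : p * a < ‖x k - x l‖ ^ (2 * s) := by nlinarith
    have hki : k ≠ i := by
      rintro rfl
      exact absurd (hfar l) (not_le.2 hbig)
    have hli : l ≠ i := by
      rintro rfl
      rw [norm_sub_rev] at hbig
      exact absurd (hfar k) (not_le.2 hbig)
    have hk : ‖x k - x i‖ ^ (2 * s) ≤ p * a := by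
      rw [norm_sub_rev]
      exact hfar k
    exact hdefect k i l hki hkl hli.symm hk
      ((mul_le_mul_of_nonneg_left hk hp0.le).trans hlt.le)
end
end

section
/- Let d be a positive integer and s ∈ (0,1) with d ≥ 4 − 2s, and let N ≥ 3 be an integer with N > d + 1. Then there exists δ = δ(d,s,N) > 0 such that for every real-valued u ∈ C_c^∞(Ω^{(N)}) one has T_s[u] ≥ (2·C_{fH}(d,s)/(N−1)) · (1 + δ/(N−2)) · ∫_{ℝ^{dN}} (Σ_{1≤i<j≤N} 1/|x_i−x_j|^{2s}) · u(x)² dx. -/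
open MeasureTheory Real

noncomputable section

/-- The normalisation constant `a_{s,d}` of the fractional Laplacian. -/
def a_sd (d : ℕ) (s : ℝ) : ℝ :=
  s * (2:ℝ) ^ (2*s - 1) * Real.pi ^ (-(d:ℝ)/2) * Real.Gamma (((d:ℝ) + 2*s)/2) /
    Real.Gamma (1 - s)

/-- The sharp fractional Hardy constant `C_{fH}(d,s)`. -/
def C_fH (d : ℕ) (s : ℝ) : ℝ :=
  (2:ℝ) ^ (2*s) * (Real.Gamma (((d:ℝ) + 2*s)/4))^2 / (Real.Gamma (((d:ℝ) - 2*s)/4))^2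

/-- The fractional kinetic energy `T_s[u]` of an `N`-particle wave function. -/
def kinetic (d N : ℕ) (s : ℝ) (u : (Fin N → Euc d) → ℝ) : ℝ :=
  ∑ i : Fin N, a_sd d s *
    ∫ x : Fin N → Euc d, ∫ z : Euc d,
      (u x - u (Function.update x i z))^2 / ‖x i - z‖ ^ ((d:ℝ) + 2*s)

section Auxiliary

open Set

lemma lintegral_ofReal_eq_of_integral_eq {α : Type*} [MeasurableSpace α] {μ : Measure α}
    {f : α → ℝ} {c : ℝ} (hc : 0 < c) (hf : 0 ≤ᵐ[μ] f) (h : ∫ x, f x ∂μ = c) :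
    ∫⁻ x, ENNReal.ofReal (f x) ∂μ = ENNReal.ofReal c := by
  rw [← ofReal_integral_eq_lintegral_ofReal (.of_integral_ne_zero (by rw [h]; exact hc.ne')) hf, h]

lemma setLIntegral_Ioi_zero_comp_mul_left {c : ℝ} (hc : 0 < c) (F : ℝ → ENNReal) :
    ∫⁻ t in Ioi (0 : ℝ), F t = ENNReal.ofReal c * ∫⁻ t in Ioi (0 : ℝ), F (c * t) := by
  have himg : (fun t : ℝ => c * t) '' Ioi 0 = Ioi 0 := by
    rw [image_mul_left_Ioi hc, mul_zero]
  have := lintegral_image_eq_lintegral_abs_deriv_mul (s := Ioi (0 : ℝ)) (f := fun t => c * t)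
    (f' := fun _ => c) measurableSet_Ioi
    (fun x _ => by simpa using ((hasDerivAt_id x).const_mul c).hasDerivWithinAt)
    (fun x _ y _ h => mul_left_cancel₀ hc.ne' h) F
  rw [himg] at this
  rw [this, lintegral_const_mul' _ _ ENNReal.ofReal_ne_top, abs_of_pos hc]

lemma setLIntegral_Ioi_zero_comp_add_left {t : ℝ} (ht : 0 ≤ t) (F : ℝ → ENNReal) :
    ∫⁻ τ in Ioi (0 : ℝ), F (t + τ) = ∫⁻ τ in Ioi (0 : ℝ), if t < τ then F τ else 0 := by
  rw [← lintegral_indicator measurableSet_Ioi, ← lintegral_indicator measurableSet_Ioi]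
  conv_rhs => rw [← lintegral_add_left_eq_self _ t]
  congr 1 with τ
  by_cases h : 0 < τ
  · have h2 : 0 < t + τ := by linarith
    simp [indicator, h, h2]
  · simp [indicator, h]

lemma lintegral_rpow_mul_exp_neg_mul {γ r : ℝ} (hγ : 0 < γ) (hr : 0 < r) :
    ∫⁻ t in Ioi (0 : ℝ), ENNReal.ofReal (t ^ (γ - 1) * exp (-(r * t))) =
      ENNReal.ofReal (Real.Gamma γ * r ^ (-γ)) := by
  apply lintegral_ofReal_eq_of_integral_eq
  · have := Real.Gamma_pos_of_pos hγ
    positivity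
  · filter_upwards [ae_restrict_mem measurableSet_Ioi] with t (ht : 0 < t)
    simp only [Pi.zero_apply]
    positivity
  · rw [Real.integral_rpow_mul_exp_neg_mul_Ioi hγ hr, one_div, Real.inv_rpow hr.le,
      Real.rpow_neg hr.le, mul_comm]

lemma lintegral_rpow_mul_exp_neg_div {γ r : ℝ} (hγ : 0 < γ) (hr : 0 < r) :
    ∫⁻ t in Ioi (0 : ℝ), ENNReal.ofReal (t ^ (-γ - 1) * exp (-(r / t))) =
      ENNReal.ofReal (Real.Gamma γ * r ^ (-γ)) := by
  apply lintegral_ofReal_eq_of_integral_eq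
  · have := Real.Gamma_pos_of_pos hγ
    positivity
  · filter_upwards [ae_restrict_mem measurableSet_Ioi] with t (ht : 0 < t)
    simp only [Pi.zero_apply]
    positivity
  · have h := integral_comp_rpow_Ioi (fun t : ℝ => t ^ (γ - 1) * exp (-(r * t))) (p := -1)
      (by norm_num)
    rw [Real.integral_rpow_mul_exp_neg_mul_Ioi hγ hr] at h
    rw [one_div, Real.inv_rpow hr.le, ← Real.rpow_neg hr.le, mul_comm] at h
    rw [← h]
    refine setIntegral_congr_fun measurableSet_Ioi fun t (ht : 0 < t) => ?_
    simp only [abs_neg, abs_one, one_mul, smul_eq_mul, ← Real.rpow_mul ht.le]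
    rw [← mul_assoc, ← Real.rpow_add ht, Real.rpow_neg_one, div_eq_mul_inv]
    congr 2
    ring

lemma lintegral_Ioi_zero_ite_lt_rpow {s r : ℝ} (hs : 0 < s) (hr : 0 < r) :
    ∫⁻ t in Ioi (0 : ℝ), (if r < t then ENNReal.ofReal (t ^ (-1 - s)) else 0) =
      ENNReal.ofReal (r ^ (-s) / s) := by
  have h1 : ∫⁻ t in Ioi (0 : ℝ), (if r < t then ENNReal.ofReal (t ^ (-1 - s)) else 0) =
      ∫⁻ t in Ioi r, ENNReal.ofReal (t ^ (-1 - s)) := by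
    rw [← lintegral_indicator measurableSet_Ioi, ← lintegral_indicator measurableSet_Ioi]
    congr 1 with t
    by_cases h : r < t
    · simp [indicator, h, hr.trans h]
    · simp [indicator, h]
  rw [h1]
  apply lintegral_ofReal_eq_of_integral_eq
  · positivity
  · filter_upwards [ae_restrict_mem measurableSet_Ioi] with t (ht : r < t)
    have : 0 < t := hr.trans ht
    simp only [Pi.zero_apply]
    positivity
  · rw [integral_Ioi_rpow_of_lt (by linarith) hr]
    have : -1 - s + 1 = -s := by ring
    rw [this, neg_div_neg_eq]

lemma lintegral_rpow_mul_one_sub_exp {s : ℝ} (hs : 0 < s) (hs1 : s < 1) :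
    ∫⁻ t in Ioi (0 : ℝ), ENNReal.ofReal (t ^ (-1 - s)) * ENNReal.ofReal (1 - exp (-t)) =
      ENNReal.ofReal (Real.Gamma (1 - s) / s) := by
  have h1 : ∀ t ∈ Ioi (0 : ℝ), ENNReal.ofReal (t ^ (-1 - s)) * ENNReal.ofReal (1 - exp (-t)) =
      ∫⁻ r in Ioi (0 : ℝ), (if r < t then ENNReal.ofReal (t ^ (-1 - s)) else 0) *
        ENNReal.ofReal (exp (-r)) := by
    intro t (ht : 0 < t)
    have h2 : ∫⁻ r in Ioi (0 : ℝ), (if r < t then ENNReal.ofReal (t ^ (-1 - s)) else 0) *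
        ENNReal.ofReal (exp (-r)) =
        ∫⁻ r in Ioo (0 : ℝ) t, ENNReal.ofReal (t ^ (-1 - s)) * ENNReal.ofReal (exp (-r)) := by
      rw [← lintegral_indicator measurableSet_Ioi, ← lintegral_indicator measurableSet_Ioo]
      congr 1 with r
      by_cases h : 0 < r <;> by_cases h' : r < t <;> simp [indicator, h, h']
    rw [h2, lintegral_const_mul' _ _ ENNReal.ofReal_ne_top]
    congr 1
    symm
    apply lintegral_ofReal_eq_of_integral_eq
    · have : exp (-t) < 1 := by rw [Real.exp_lt_one_iff]; linarith
      linarith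
    · filter_upwards with r
      exact (exp_pos _).le
    · rw [← integral_Ioc_eq_integral_Ioo, ← intervalIntegral.integral_of_le ht.le]
      simp [intervalIntegral.integral_comp_neg (fun x => Real.exp x)]
  rw [setLIntegral_congr_fun measurableSet_Ioi h1, lintegral_lintegral_swap]
  · have h3 : ∀ r ∈ Ioi (0 : ℝ), ∫⁻ t in Ioi (0 : ℝ),
        (if r < t then ENNReal.ofReal (t ^ (-1 - s)) else 0) * ENNReal.ofReal (exp (-r)) =
        ENNReal.ofReal (1 / s) * ENNReal.ofReal (r ^ ((1 - s) - 1) * exp (-(1 * r))) := by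
      intro r (hr : 0 < r)
      rw [lintegral_mul_const' _ _ ENNReal.ofReal_ne_top, lintegral_Ioi_zero_ite_lt_rpow hs hr,
        ← ENNReal.ofReal_mul (by positivity), ← ENNReal.ofReal_mul (by positivity)]
      congr 1
      rw [show (1 - s - 1) = -s by ring, one_mul]
      ring
    rw [setLIntegral_congr_fun measurableSet_Ioi h3, lintegral_const_mul' _ _ ENNReal.ofReal_ne_top,
      lintegral_rpow_mul_exp_neg_mul (by linarith) one_pos, ← ENNReal.ofReal_mul (by positivity)]
    congr 1
    simp
    ring
  · apply Measurable.aemeasurable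
    simp only [Function.uncurry_def]
    refine Measurable.mul (Measurable.ite ?_ (by fun_prop) (by fun_prop)) (by fun_prop)
    exact measurableSet_lt measurable_snd measurable_fst

/-- The heat kernel `(4πt)^{-d/2} exp(-‖x‖²/(4t))` on `ℝ^d`. -/
def heatKernel (d : ℕ) (t : ℝ) (x : Euc d) : ℝ :=
  (4 * Real.pi * t) ^ (-(d : ℝ) / 2) * exp (-(‖x‖ ^ 2 / (4 * t)))

lemma heatKernel_nonneg {d : ℕ} {t : ℝ} (ht : 0 ≤ t) (x : Euc d) : 0 ≤ heatKernel d t x := by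
  unfold heatKernel
  positivity

lemma heatKernel_neg {d : ℕ} (t : ℝ) (x : Euc d) : heatKernel d t (-x) = heatKernel d t x := by
  simp [heatKernel]

lemma measurable_heatKernel (d : ℕ) :
    Measurable fun q : ℝ × Euc d => heatKernel d q.1 q.2 := by
  unfold heatKernel
  fun_prop

lemma lintegral_heatKernel {d : ℕ} {t : ℝ} (ht : 0 < t) :
    ∫⁻ x : Euc d, ENNReal.ofReal (heatKernel d t x) = 1 := by
  rw [← ENNReal.ofReal_one]
  apply lintegral_ofReal_eq_of_integral_eq one_pos
  · filter_upwards with x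
    exact heatKernel_nonneg ht.le x
  · have h := GaussianFourier.integral_rexp_neg_mul_sq_norm (V := Euc d) (b := 1 / (4 * t))
      (by positivity)
    have h2 : ∀ x : Euc d, heatKernel d t x =
        (4 * Real.pi * t) ^ (-(d : ℝ) / 2) * exp (-(1 / (4 * t)) * ‖x‖ ^ 2) := by
      intro x
      unfold heatKernel
      congr 2
      ring
    simp_rw [h2]
    rw [integral_const_mul, h, finrank_euclideanSpace_fin, neg_div,
      Real.rpow_neg (by positivity)]
    have : Real.pi / (1 / (4 * t)) = 4 * Real.pi * t := by field_simp
    rw [this, inv_mul_cancel₀ (by positivity)]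

lemma heatKernel_mul_heatKernel {d : ℕ} {t τ : ℝ} (ht : 0 < t) (hτ : 0 < τ) (a b : Euc d) :
    heatKernel d t a * heatKernel d τ b =
      heatKernel d (t + τ) (a + b) *
        heatKernel d (t * τ / (t + τ)) ((t + τ)⁻¹ • (t • b - τ • a)) := by
  have h : 0 < t + τ := by positivity
  unfold heatKernel
  rw [mul_mul_mul_comm, mul_mul_mul_comm ((4 * Real.pi * (t + τ)) ^ (-(d : ℝ) / 2)),
    ← Real.mul_rpow (by positivity) (by positivity),
    ← Real.mul_rpow (by positivity) (by positivity), ← Real.exp_add, ← Real.exp_add]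
  congr 2
  · field_simp
  · rw [norm_smul, mul_pow, @norm_sub_sq_real, @norm_add_sq_real, norm_smul, norm_smul,
      inner_smul_left, inner_smul_right, real_inner_comm b a]
    simp only [Real.norm_eq_abs, mul_pow, sq_abs, RCLike.conj_to_real]
    field_simp
    ring

lemma lintegral_heatKernel_mul_heatKernel {d : ℕ} {t τ : ℝ} (ht : 0 < t) (hτ : 0 < τ)
    (x y : Euc d) :
    ∫⁻ x', ENNReal.ofReal (heatKernel d t (x - x')) * ENNReal.ofReal (heatKernel d τ (x' - y)) =
      ENNReal.ofReal (heatKernel d (t + τ) (x - y)) := by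
  have h : 0 < t + τ := by positivity
  have h1 : ∀ x' : Euc d,
      ENNReal.ofReal (heatKernel d t (x - x')) * ENNReal.ofReal (heatKernel d τ (x' - y)) =
      ENNReal.ofReal (heatKernel d (t + τ) (x - y)) *
        ENNReal.ofReal (heatKernel d (t * τ / (t + τ))
          (x' - (t + τ)⁻¹ • (t • y + τ • x))) := by
    intro x'
    rw [← ENNReal.ofReal_mul (heatKernel_nonneg ht.le _),
      ← ENNReal.ofReal_mul (heatKernel_nonneg h.le _), heatKernel_mul_heatKernel ht hτ]
    congr 3
    · abel
    · have : x' = (t + τ)⁻¹ • ((t + τ) • x') := by rw [smul_smul, inv_mul_cancel₀ h.ne', one_smul]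
      rw [eq_sub_iff_add_eq, ← smul_add]
      conv_rhs => rw [this]
      congr 1
      simp only [smul_sub, add_smul]
      abel
  simp_rw [h1]
  rw [lintegral_const_mul' _ _ ENNReal.ofReal_ne_top,
    lintegral_sub_right_eq_self (fun x' => ENNReal.ofReal (heatKernel d (t * τ / (t + τ)) x')),
    lintegral_heatKernel (by positivity), mul_one]

/-- The constant in `∫₀^∞ τ^{β-1} p_τ(x) dτ = rieszConst d β * ‖x‖^{2β-d}`. -/
def rieszConst (d : ℕ) (β : ℝ) : ℝ :=
  Real.Gamma ((d : ℝ) / 2 - β) / ((4 : ℝ) ^ β * Real.pi ^ ((d : ℝ) / 2))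

lemma rieszConst_pos {d : ℕ} {β : ℝ} (hβ : β < (d : ℝ) / 2) : 0 < rieszConst d β := by
  have := Real.Gamma_pos_of_pos (sub_pos.2 hβ)
  unfold rieszConst
  positivity

lemma lintegral_rpow_mul_heatKernel {d : ℕ} {β : ℝ} (hβ : β < (d : ℝ) / 2) {x : Euc d}
    (hx : x ≠ 0) :
    ∫⁻ τ in Ioi (0 : ℝ), ENNReal.ofReal (τ ^ (β - 1)) * ENNReal.ofReal (heatKernel d τ x) =
      ENNReal.ofReal (rieszConst d β * ‖x‖ ^ (2 * β - d)) := by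
  have hx' : 0 < ‖x‖ := norm_pos_iff.2 hx
  have h1 : ∀ τ ∈ Ioi (0 : ℝ),
      ENNReal.ofReal (τ ^ (β - 1)) * ENNReal.ofReal (heatKernel d τ x) =
      ENNReal.ofReal ((4 * Real.pi) ^ (-(d : ℝ) / 2)) *
        ENNReal.ofReal (τ ^ (-((d : ℝ) / 2 - β) - 1) * exp (-((‖x‖ ^ 2 / 4) / τ))) := by
    intro τ (hτ : 0 < τ)
    rw [← ENNReal.ofReal_mul (by positivity), ← ENNReal.ofReal_mul (by positivity)]
    congr 1
    unfold heatKernel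
    rw [Real.mul_rpow (by positivity) hτ.le]
    have : τ ^ (-((d : ℝ) / 2 - β) - 1) = τ ^ (β - 1) * τ ^ (-(d : ℝ) / 2) := by
      rw [← Real.rpow_add hτ]
      congr 1
      ring
    rw [this, div_div]
    ring
  rw [setLIntegral_congr_fun measurableSet_Ioi h1, lintegral_const_mul' _ _ ENNReal.ofReal_ne_top,
    lintegral_rpow_mul_exp_neg_div (by linarith) (by positivity),
    ← ENNReal.ofReal_mul (by positivity)]
  congr 1
  unfold rieszConst
  rw [Real.div_rpow (by positivity) (by positivity), ← Real.rpow_natCast, ← Real.rpow_mul hx'.le,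
    Real.mul_rpow (by positivity) (by positivity)]
  have e1 : ((2 : ℕ) : ℝ) * -((d : ℝ) / 2 - β) = 2 * β - d := by push_cast; ring
  have e2 : (4 : ℝ) ^ (-((d : ℝ) / 2 - β)) = (4 : ℝ) ^ (-(d : ℝ) / 2) * 4 ^ β := by
    rw [← Real.rpow_add (by norm_num)]
    congr 1
    ring
  have e3 : Real.pi ^ (-(d : ℝ) / 2) = (Real.pi ^ ((d : ℝ) / 2))⁻¹ := by
    rw [neg_div, Real.rpow_neg (by positivity)]
  rw [e1, e2, e3]
  field_simp

/-- The weight `τ^{β-1} - (τ-t)_+^{β-1}`. -/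
def shiftWeight (β t τ : ℝ) : ℝ :=
  τ ^ (β - 1) - if t < τ then (τ - t) ^ (β - 1) else 0

lemma measurable_shiftWeight (β : ℝ) :
    Measurable fun q : ℝ × ℝ => shiftWeight β q.1 q.2 := by
  unfold shiftWeight
  refine Measurable.sub (by fun_prop) (Measurable.ite ?_ (by fun_prop) (by fun_prop))
  exact measurableSet_lt measurable_fst measurable_snd

lemma lintegral_shiftWeight_add {β t : ℝ} (hβ : 1 ≤ β) (ht : 0 < t) {g : ℝ → ENNReal}
    (hg : Measurable g) :
    (∫⁻ τ in Ioi (0 : ℝ), ENNReal.ofReal (shiftWeight β t τ) * g τ) +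
        ∫⁻ τ in Ioi (0 : ℝ), ENNReal.ofReal (τ ^ (β - 1)) * g (t + τ) =
      ∫⁻ τ in Ioi (0 : ℝ), ENNReal.ofReal (τ ^ (β - 1)) * g τ := by
  have h1 := setLIntegral_Ioi_zero_comp_add_left ht.le
    (fun τ => ENNReal.ofReal ((τ - t) ^ (β - 1)) * g τ)
  simp only [add_sub_cancel_left] at h1
  rw [h1, ← lintegral_add_left]
  · refine setLIntegral_congr_fun measurableSet_Ioi fun τ (hτ : 0 < τ) => ?_
    unfold shiftWeight
    by_cases h : t < τ
    · simp only [h, if_true]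
      have h0 : 0 ≤ (τ - t) ^ (β - 1) := Real.rpow_nonneg (by linarith) _
      have hle : (τ - t) ^ (β - 1) ≤ τ ^ (β - 1) :=
        Real.rpow_le_rpow (by linarith) (by linarith) (by linarith)
      rw [← add_mul, ← ENNReal.ofReal_add (by linarith) h0, sub_add_cancel]
    · simp [h]
  · have := (measurable_shiftWeight β).comp (measurable_prodMk_left (x := t))
    exact (ENNReal.measurable_ofReal.comp this).mul hg

lemma lintegral_shiftWeight_mul_exp {β t : ℝ} (hβ : 1 ≤ β) (ht : 0 < t) :
    ∫⁻ τ in Ioi (0 : ℝ), ENNReal.ofReal (shiftWeight β t τ) * ENNReal.ofReal (exp (-τ)) =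
      ENNReal.ofReal (Real.Gamma β) * ENNReal.ofReal (1 - exp (-t)) := by
  have hΓ : 0 < Real.Gamma β := Real.Gamma_pos_of_pos (by linarith)
  have h := lintegral_shiftWeight_add hβ ht (g := fun τ => ENNReal.ofReal (exp (-τ)))
    (by fun_prop)
  have h1 : ∫⁻ τ in Ioi (0 : ℝ), ENNReal.ofReal (τ ^ (β - 1)) * ENNReal.ofReal (exp (-τ)) =
      ENNReal.ofReal (Real.Gamma β) := by
    have := lintegral_rpow_mul_exp_neg_mul (γ := β) (r := 1) (by linarith) one_pos
    rw [Real.one_rpow, mul_one] at this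
    rw [← this]
    refine setLIntegral_congr_fun measurableSet_Ioi fun τ (hτ : 0 < τ) => ?_
    simp only [one_mul]
    rw [ENNReal.ofReal_mul (by positivity)]
  have h2 : ∫⁻ τ in Ioi (0 : ℝ), ENNReal.ofReal (τ ^ (β - 1)) * ENNReal.ofReal (exp (-(t + τ))) =
      ENNReal.ofReal (Real.Gamma β * exp (-t)) := by
    rw [ENNReal.ofReal_mul hΓ.le, ← h1, ← lintegral_mul_const' _ _ ENNReal.ofReal_ne_top]
    congr 1 with τ
    rw [neg_add, Real.exp_add, ENNReal.ofReal_mul (exp_pos _).le]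
    ring
  rw [h1, h2] at h
  rw [ENNReal.eq_sub_of_add_eq ENNReal.ofReal_ne_top h, ← ENNReal.ofReal_sub _ (by positivity),
    ← ENNReal.ofReal_mul hΓ.le]
  congr 1
  ring

lemma lintegral_rpow_mul_shiftWeight_eq_mul {β s τ : ℝ} (hτ : 0 < τ) :
    ∫⁻ t in Ioi (0 : ℝ), ENNReal.ofReal (t ^ (-1 - s)) * ENNReal.ofReal (shiftWeight β t τ) =
      ENNReal.ofReal (τ ^ (β - s - 1)) *
        ∫⁻ t in Ioi (0 : ℝ), ENNReal.ofReal (t ^ (-1 - s)) * ENNReal.ofReal (shiftWeight β t 1) := by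
  rw [setLIntegral_Ioi_zero_comp_mul_left hτ, ← lintegral_const_mul' _ _ ENNReal.ofReal_ne_top,
    ← lintegral_const_mul' _ _ ENNReal.ofReal_ne_top]
  refine setLIntegral_congr_fun measurableSet_Ioi fun t (ht : 0 < t) => ?_
  have h1 : shiftWeight β (τ * t) τ = τ ^ (β - 1) * shiftWeight β t 1 := by
    unfold shiftWeight
    have h3 : τ * t < τ ↔ t < 1 := by
      constructor <;> intro h <;> nlinarith
    by_cases h : t < 1
    · simp only [h3, h, if_true]
      rw [show τ - τ * t = τ * (1 - t) by ring, Real.mul_rpow hτ.le (by linarith)]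
      simp
      ring
    · simp [h3, h]
  have h2 : τ ^ (β - s - 1) = τ * τ ^ (-1 - s) * τ ^ (β - 1) := by
    nth_rewrite 2 [← Real.rpow_one τ]
    rw [← Real.rpow_add hτ, ← Real.rpow_add hτ]
    congr 1
    ring
  rw [h1, h2, Real.mul_rpow hτ.le ht.le, ENNReal.ofReal_mul (by positivity),
    ENNReal.ofReal_mul (by positivity), ENNReal.ofReal_mul (by positivity),
    ENNReal.ofReal_mul (by positivity)]
  ring

/-- The fractional derivative of order `s` of a power. -/
lemma lintegral_rpow_mul_shiftWeight {β s τ : ℝ} (hβ : 1 ≤ β) (hs : 0 < s) (hs1 : s < 1)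
    (hτ : 0 < τ) :
    ∫⁻ t in Ioi (0 : ℝ), ENNReal.ofReal (t ^ (-1 - s)) * ENNReal.ofReal (shiftWeight β t τ) =
      ENNReal.ofReal (τ ^ (β - s - 1)) *
        ENNReal.ofReal (Real.Gamma β * Real.Gamma (1 - s) / (s * Real.Gamma (β - s))) := by
  have hΓ : 0 < Real.Gamma β := Real.Gamma_pos_of_pos (by linarith)
  have hΓ' : 0 < Real.Gamma (β - s) := Real.Gamma_pos_of_pos (by linarith)
  have hΓ'' : 0 < Real.Gamma (1 - s) := Real.Gamma_pos_of_pos (by linarith)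
  rw [lintegral_rpow_mul_shiftWeight_eq_mul hτ]
  congr 1
  set κ := ∫⁻ t in Ioi (0 : ℝ), ENNReal.ofReal (t ^ (-1 - s)) *
    ENNReal.ofReal (shiftWeight β t 1) with hκ
  have hmeas := measurable_shiftWeight β
  have h1 : ∫⁻ τ in Ioi (0 : ℝ), ∫⁻ t in Ioi (0 : ℝ), ENNReal.ofReal (t ^ (-1 - s)) *
      ENNReal.ofReal (shiftWeight β t τ) * ENNReal.ofReal (exp (-τ)) =
      ENNReal.ofReal (Real.Gamma (β - s)) * κ := by
    have := lintegral_rpow_mul_exp_neg_mul (γ := β - s) (r := 1) (by linarith) one_pos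
    rw [Real.one_rpow, mul_one] at this
    rw [← this, ← lintegral_mul_const'' _ (by fun_prop)]
    refine setLIntegral_congr_fun measurableSet_Ioi fun τ (hτ : 0 < τ) => ?_
    rw [lintegral_mul_const' _ _ ENNReal.ofReal_ne_top, lintegral_rpow_mul_shiftWeight_eq_mul hτ,
      one_mul, ENNReal.ofReal_mul (by positivity)]
    ring
  have h2 : ∫⁻ τ in Ioi (0 : ℝ), ∫⁻ t in Ioi (0 : ℝ), ENNReal.ofReal (t ^ (-1 - s)) *
      ENNReal.ofReal (shiftWeight β t τ) * ENNReal.ofReal (exp (-τ)) =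
      ENNReal.ofReal (Real.Gamma β) * ENNReal.ofReal (Real.Gamma (1 - s) / s) := by
    rw [lintegral_lintegral_swap]
    · rw [← lintegral_rpow_mul_one_sub_exp hs hs1,
        ← lintegral_const_mul' _ _ ENNReal.ofReal_ne_top]
      refine setLIntegral_congr_fun measurableSet_Ioi fun t (ht : 0 < t) => ?_
      simp only [mul_assoc]
      rw [lintegral_const_mul' _ _ ENNReal.ofReal_ne_top, lintegral_shiftWeight_mul_exp hβ ht]
      ring
    · apply Measurable.aemeasurable
      have : Measurable fun q : ℝ × ℝ => shiftWeight β q.2 q.1 := hmeas.comp measurable_swap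
      simp only [Function.uncurry_def]
      fun_prop
  rw [h2] at h1
  have h3 : ENNReal.ofReal (Real.Gamma (β - s)) ≠ 0 := by simpa using hΓ'
  rw [← ENNReal.mul_right_inj h3 ENNReal.ofReal_ne_top, ← h1, ← ENNReal.ofReal_mul hΓ.le,
    ← ENNReal.ofReal_mul hΓ'.le]
  congr 1
  field_simp

@[fun_prop]
lemma Measurable.heatKernel {γ : Type*} [MeasurableSpace γ] {d : ℕ} {f : γ → ℝ} {g : γ → Euc d}
    (hf : Measurable f) (hg : Measurable g) : Measurable fun a => heatKernel d (f a) (g a) :=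
  (measurable_heatKernel d).comp (hf.prodMk hg)

@[fun_prop]
lemma Measurable.shiftWeight {γ : Type*} [MeasurableSpace γ] {β : ℝ} {f g : γ → ℝ}
    (hf : Measurable f) (hg : Measurable g) : Measurable fun a => shiftWeight β (f a) (g a) :=
  (measurable_shiftWeight β).comp (hf.prodMk hg)

/-- The relative defect `1 - P_t φ / φ` of the virtual ground state `φ(x) = ‖x‖^{-(d-2s)/2}` under
the heat semigroup. -/
def heatDefect (d : ℕ) (s t : ℝ) (x : Euc d) : ENNReal :=
  (∫⁻ τ in Ioi (0 : ℝ), ENNReal.ofReal (shiftWeight ((d + 2 * s) / 4) t τ) *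
      ENNReal.ofReal (heatKernel d τ x)) /
    ENNReal.ofReal (rieszConst d ((d + 2 * s) / 4) * ‖x‖ ^ (-((d - 2 * s) / 2)))

@[fun_prop]
lemma Measurable.heatDefect {γ : Type*} [MeasurableSpace γ] {d : ℕ} {s : ℝ} {f : γ → ℝ}
    {g : γ → Euc d} (hf : Measurable f) (hg : Measurable g) :
    Measurable fun a => heatDefect d s (f a) (g a) := by
  unfold _root_.heatDefect
  refine Measurable.div (Measurable.lintegral_prod_right' (f := fun q : γ × ℝ =>
    ENNReal.ofReal (_root_.shiftWeight ((d + 2 * s) / 4) (f q.1) q.2) *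
      ENNReal.ofReal (_root_.heatKernel d q.2 (g q.1))) ?_) ?_
  · fun_prop
  · fun_prop

/-- The square root of `φ(x' - y) / φ(x - y)` for `φ(x) = ‖x‖^{-(d-2s)/2}`. -/
def poleRatio (d : ℕ) (s : ℝ) (y x x' : Euc d) : ℝ :=
  (‖x - y‖ / ‖x' - y‖) ^ (((d : ℝ) - 2 * s) / 4)

@[fun_prop]
lemma Measurable.poleRatio {γ : Type*} [MeasurableSpace γ] {d : ℕ} {s : ℝ}
    {f g h : γ → Euc d} (hf : Measurable f) (hg : Measurable g) (hh : Measurable h) :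
    Measurable fun a => poleRatio d s (f a) (g a) (h a) := by
  unfold _root_.poleRatio
  fun_prop

lemma poleRatio_pos {d : ℕ} {s : ℝ} {y x x' : Euc d} (hx : x ≠ y) (hx' : x' ≠ y) :
    0 < poleRatio d s y x x' := by
  have h1 : 0 < ‖x - y‖ := norm_pos_iff.2 (sub_ne_zero.2 hx)
  have h2 : 0 < ‖x' - y‖ := norm_pos_iff.2 (sub_ne_zero.2 hx')
  unfold poleRatio
  positivity

lemma poleRatio_swap {d : ℕ} {s : ℝ} (y x x' : Euc d) :
    poleRatio d s y x' x = (poleRatio d s y x x')⁻¹ := by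
  unfold poleRatio
  rw [← Real.inv_rpow (by positivity), inv_div]

lemma poleRatio_sq {d : ℕ} {s : ℝ} {y x x' : Euc d} (hx : x ≠ y) (hx' : x' ≠ y) :
    poleRatio d s y x x' ^ 2 =
      ‖x' - y‖ ^ (-(((d : ℝ) - 2 * s) / 2)) / ‖x - y‖ ^ (-(((d : ℝ) - 2 * s) / 2)) := by
  have h1 : 0 < ‖x - y‖ := norm_pos_iff.2 (sub_ne_zero.2 hx)
  have h2 : 0 < ‖x' - y‖ := norm_pos_iff.2 (sub_ne_zero.2 hx')
  unfold poleRatio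
  rw [← Real.rpow_natCast, ← Real.rpow_mul (by positivity), Real.div_rpow h1.le h2.le,
    Real.rpow_neg h1.le, Real.rpow_neg h2.le]
  have : ((d : ℝ) - 2 * s) / 4 * ((2 : ℕ) : ℝ) = (d - 2 * s) / 2 := by push_cast; ring
  rw [this]
  field_simp

lemma lintegral_heatKernel_mul_riesz {d : ℕ} (hd : 0 < d) {β t : ℝ} (hβ : β < (d : ℝ) / 2)
    (ht : 0 < t) (x y : Euc d) :
    ∫⁻ x', ENNReal.ofReal (heatKernel d t (x - x')) *
        ENNReal.ofReal (rieszConst d β * ‖x' - y‖ ^ (2 * β - d)) =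
      ∫⁻ τ in Ioi (0 : ℝ), ENNReal.ofReal (τ ^ (β - 1)) *
        ENNReal.ofReal (heatKernel d (t + τ) (x - y)) := by
  have : Nonempty (Fin d) := ⟨⟨0, hd⟩⟩
  have h1 : ∀ᵐ x' : Euc d, ENNReal.ofReal (heatKernel d t (x - x')) *
        ENNReal.ofReal (rieszConst d β * ‖x' - y‖ ^ (2 * β - d)) =
      ∫⁻ τ in Ioi (0 : ℝ), ENNReal.ofReal (heatKernel d t (x - x')) *
        (ENNReal.ofReal (τ ^ (β - 1)) * ENNReal.ofReal (heatKernel d τ (x' - y))) := by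
    filter_upwards [Measure.ae_ne volume y] with x' hx'
    rw [lintegral_const_mul' _ _ ENNReal.ofReal_ne_top,
      lintegral_rpow_mul_heatKernel hβ (sub_ne_zero.2 hx')]
  rw [lintegral_congr_ae h1, lintegral_lintegral_swap]
  · refine setLIntegral_congr_fun measurableSet_Ioi fun τ (hτ : 0 < τ) => ?_
    rw [← lintegral_heatKernel_mul_heatKernel ht hτ, ← lintegral_const_mul' _ _
      ENNReal.ofReal_ne_top]
    congr 1 with x'
    ring
  · apply Measurable.aemeasurable
    simp only [Function.uncurry_def]
    fun_prop

lemma heatDefect_add_lintegral {d : ℕ} (hd : 0 < d) {s t : ℝ} (hs : s ∈ Set.Ioo (0:ℝ) 1)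
    (hds : (4:ℝ) - 2*s ≤ (d:ℝ)) (ht : 0 < t) {x y : Euc d} (hxy : x ≠ y) :
    heatDefect d s t (x - y) + ∫⁻ x', ENNReal.ofReal (poleRatio d s y x x' ^ 2) *
      ENNReal.ofReal (heatKernel d t (x - x')) = 1 := by
  have : Nonempty (Fin d) := ⟨⟨0, hd⟩⟩
  have h0 : 0 < ‖x - y‖ := norm_pos_iff.2 (sub_ne_zero.2 hxy)
  obtain ⟨hs0, hs1⟩ := hs
  have hβ : (d + 2 * s) / 4 < (d : ℝ) / 2 := by linarith
  have hβ1 : 1 ≤ ((d : ℝ) + 2 * s) / 4 := by linarith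
  have he : 2 * (((d : ℝ) + 2 * s) / 4) - d = -((d - 2 * s) / 2) := by ring
  have hc := rieszConst_pos hβ
  have h1 := lintegral_heatKernel_mul_riesz hd hβ ht x y
  have h2 := lintegral_shiftWeight_add hβ1 ht
    (g := fun τ => ENNReal.ofReal (heatKernel d τ (x - y))) (by fun_prop)
  rw [← h1, lintegral_rpow_mul_heatKernel hβ (sub_ne_zero.2 hxy), he] at h2
  have h3 : ∀ᵐ x' : Euc d, ENNReal.ofReal (poleRatio d s y x x' ^ 2) *
      ENNReal.ofReal (heatKernel d t (x - x')) =
      (ENNReal.ofReal (heatKernel d t (x - x')) *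
        ENNReal.ofReal (rieszConst d ((d + 2 * s) / 4) * ‖x' - y‖ ^ (-(((d : ℝ) - 2 * s) / 2)))) *
      (ENNReal.ofReal (rieszConst d ((d + 2 * s) / 4) *
        ‖x - y‖ ^ (-(((d : ℝ) - 2 * s) / 2))))⁻¹ := by
    filter_upwards [Measure.ae_ne volume y] with x' hx'
    rw [poleRatio_sq hxy hx', mul_comm, mul_assoc, ← div_eq_mul_inv,
      ← ENNReal.ofReal_div_of_pos (by positivity)]
    congr 2
    field_simp
  rw [lintegral_congr_ae h3, lintegral_mul_const' _ _ (by
    simp only [ne_eq, ENNReal.inv_eq_top, ENNReal.ofReal_eq_zero, not_le]; positivity),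
    heatDefect, ← div_eq_mul_inv, ← ENNReal.add_div, h2, ENNReal.div_self]
  · simp only [ne_eq, ENNReal.ofReal_eq_zero, not_le]; positivity
  · exact ENNReal.ofReal_ne_top

lemma C_fH_pos {d : ℕ} {s : ℝ} (hs : 0 < s) (hds : 2 * s < d) : 0 < C_fH d s := by
  have h1 : 0 < Real.Gamma (((d:ℝ) + 2*s)/4) := Real.Gamma_pos_of_pos (by linarith)
  have h2 : 0 < Real.Gamma (((d:ℝ) - 2*s)/4) := Real.Gamma_pos_of_pos (by linarith)
  unfold C_fH
  positivity

lemma a_sd_pos {d : ℕ} {s : ℝ} (hs : s ∈ Set.Ioo (0:ℝ) 1) : 0 < a_sd d s := by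
  obtain ⟨hs0, hs1⟩ := hs
  have h1 : 0 < Real.Gamma (((d:ℝ) + 2*s)/2) := Real.Gamma_pos_of_pos (by positivity)
  have h2 : 0 < Real.Gamma (1 - s) := Real.Gamma_pos_of_pos (by linarith)
  unfold a_sd
  positivity

lemma rieszConst_neg {d : ℕ} {s : ℝ} (hs : s ∈ Set.Ioo (0:ℝ) 1) :
    rieszConst d (-s) = 2 * (Real.Gamma (1 - s) / s) * a_sd d s := by
  obtain ⟨hs0, hs1⟩ := hs
  have h2 : 0 < Real.Gamma (1 - s) := Real.Gamma_pos_of_pos (by linarith)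
  unfold rieszConst a_sd
  have e1 : (d : ℝ) / 2 - -s = (d + 2 * s) / 2 := by ring
  have e2 : (4 : ℝ) ^ (-s) = (2 * 2 ^ (2 * s - 1))⁻¹ := by
    rw [Real.rpow_neg (by norm_num), show (4 : ℝ) = 2 ^ (2 : ℝ) by norm_num,
      ← Real.rpow_mul (by norm_num), Real.rpow_sub_one (by norm_num)]
    congr 1
    field_simp
  rw [e1, e2, neg_div, Real.rpow_neg Real.pi_pos.le]
  field_simp

lemma rieszConst_ratio {d : ℕ} {s : ℝ} (hs : s ∈ Set.Ioo (0:ℝ) 1) (hds : 2 * s < d) :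
    Real.Gamma ((d + 2 * s) / 4) * Real.Gamma (1 - s) /
        (s * Real.Gamma ((d + 2 * s) / 4 - s)) * rieszConst d ((d + 2 * s) / 4 - s) =
      Real.Gamma (1 - s) / s * C_fH d s * rieszConst d ((d + 2 * s) / 4) := by
  obtain ⟨hs0, hs1⟩ := hs
  have e1 : ((d : ℝ) + 2 * s) / 4 - s = (d - 2 * s) / 4 := by ring
  have e2 : (d : ℝ) / 2 - (d + 2 * s) / 4 = (d - 2 * s) / 4 := by ring
  have e3 : (d : ℝ) / 2 - (d - 2 * s) / 4 = (d + 2 * s) / 4 := by ring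
  have h2 : 0 < Real.Gamma (((d:ℝ) - 2*s)/4) := Real.Gamma_pos_of_pos (by linarith)
  have e4 : (4 : ℝ) ^ (((d : ℝ) + 2 * s) / 4) = 2 ^ (2 * s) * 4 ^ (((d : ℝ) - 2 * s) / 4) := by
    rw [Real.rpow_mul (by norm_num), show (2 : ℝ) ^ (2 : ℝ) = 4 by norm_num,
      ← Real.rpow_add (by norm_num)]
    congr 1
    ring
  rw [e1]
  unfold rieszConst C_fH
  rw [e2, e3, e4]
  field_simp

/-- Ground state identity `(-Δ)^s φ = C_fH ‖x‖^{-2s} φ`, in terms of the heat semigroup. -/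
lemma lintegral_rpow_mul_heatDefect {d : ℕ} {s : ℝ} (hs : s ∈ Set.Ioo (0:ℝ) 1)
    (hds : (4:ℝ) - 2*s ≤ (d:ℝ)) {x : Euc d} (hx : x ≠ 0) :
    ∫⁻ t in Ioi (0 : ℝ), ENNReal.ofReal (t ^ (-1 - s)) * heatDefect d s t x =
      ENNReal.ofReal (Real.Gamma (1 - s) / s * C_fH d s * ‖x‖ ^ (-(2 * s))) := by
  have h0 : 0 < ‖x‖ := norm_pos_iff.2 hx
  have hratio := rieszConst_ratio (d := d) hs (by linarith [hs.2])
  obtain ⟨hs0, hs1⟩ := hs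
  have hβ : (d + 2 * s) / 4 < (d : ℝ) / 2 := by linarith
  have hβ1 : 1 ≤ ((d : ℝ) + 2 * s) / 4 := by linarith
  have hc := rieszConst_pos hβ
  have hG1 : 0 < Real.Gamma (((d:ℝ) + 2*s)/4) := Real.Gamma_pos_of_pos (by linarith)
  have hG2 : 0 < Real.Gamma (((d:ℝ) + 2*s)/4 - s) := Real.Gamma_pos_of_pos (by linarith)
  have hG3 : 0 < Real.Gamma (1 - s) := Real.Gamma_pos_of_pos (by linarith)
  have h1 : ∫⁻ t in Ioi (0 : ℝ), ∫⁻ τ in Ioi (0 : ℝ), ENNReal.ofReal (t ^ (-1 - s)) *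
      (ENNReal.ofReal (shiftWeight ((d + 2 * s) / 4) t τ) * ENNReal.ofReal (heatKernel d τ x)) =
      ENNReal.ofReal (Real.Gamma (1 - s) / s * C_fH d s * rieszConst d ((d + 2 * s) / 4) *
        ‖x‖ ^ (-(((d : ℝ) - 2 * s) / 2) + -(2 * s))) := by
    rw [lintegral_lintegral_swap, ← hratio]
    · have h2 : ∀ τ ∈ Ioi (0 : ℝ), ∫⁻ t in Ioi (0 : ℝ), ENNReal.ofReal (t ^ (-1 - s)) *
          (ENNReal.ofReal (shiftWeight ((d + 2 * s) / 4) t τ) *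
            ENNReal.ofReal (heatKernel d τ x)) =
          ENNReal.ofReal (Real.Gamma ((d + 2 * s) / 4) * Real.Gamma (1 - s) /
            (s * Real.Gamma ((d + 2 * s) / 4 - s))) *
          (ENNReal.ofReal (τ ^ (((d + 2 * s) / 4 - s) - 1)) *
            ENNReal.ofReal (heatKernel d τ x)) := by
        intro τ (hτ : 0 < τ)
        simp only [← mul_assoc]
        rw [lintegral_mul_const' _ _ ENNReal.ofReal_ne_top,
          lintegral_rpow_mul_shiftWeight hβ1 hs0 hs1 hτ]
        ring
      rw [setLIntegral_congr_fun measurableSet_Ioi h2,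
        lintegral_const_mul' _ _ ENNReal.ofReal_ne_top,
        lintegral_rpow_mul_heatKernel (by linarith) hx, ← ENNReal.ofReal_mul (by positivity)]
      congr 1
      rw [mul_assoc]
      congr 3
      ring
    · apply Measurable.aemeasurable
      simp only [Function.uncurry_def]
      fun_prop
  simp only [heatDefect, div_eq_mul_inv, ← mul_assoc]
  rw [lintegral_mul_const' _ _ (by
    simp only [ne_eq, ENNReal.inv_eq_top, ENNReal.ofReal_eq_zero, not_le]; positivity)]
  have h3 : ∀ t ∈ Ioi (0 : ℝ), ENNReal.ofReal (t ^ (-1 - s)) * ∫⁻ τ in Ioi (0 : ℝ),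
      (ENNReal.ofReal (shiftWeight ((d + 2 * s) * 4⁻¹) t τ) * ENNReal.ofReal (heatKernel d τ x)) =
      ∫⁻ τ in Ioi (0 : ℝ), ENNReal.ofReal (t ^ (-1 - s)) *
      (ENNReal.ofReal (shiftWeight ((d + 2 * s) / 4) t τ) *
        ENNReal.ofReal (heatKernel d τ x)) := by
    intro t _
    rw [lintegral_const_mul' _ _ ENNReal.ofReal_ne_top]
    simp only [div_eq_mul_inv]
  rw [setLIntegral_congr_fun measurableSet_Ioi h3, h1, ← div_eq_mul_inv,
    ← ENNReal.ofReal_div_of_pos (by rw [← div_eq_mul_inv]; positivity)]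
  congr 1
  rw [Real.rpow_add h0]
  simp only [← div_eq_mul_inv]
  generalize rieszConst d ((d + 2 * s) / 4) = c at hc
  field_simp

lemma two_pole_pointwise (u v : ℝ) {p q : ℝ} (hp : 0 < p) (hq : 0 < q) :
    u ^ 2 * (p - q) ^ 2 + 2 * u ^ 2 + 2 * v ^ 2 ≤
      2 * (u - v) ^ 2 + u ^ 2 * (p ^ 2 + q ^ 2) + v ^ 2 * (p⁻¹ ^ 2 + q⁻¹ ^ 2) := by
  have h1 : 0 ≤ 2 * (u * p - v * q⁻¹) * (u * q - v * p⁻¹) + v ^ 2 * (p⁻¹ - q⁻¹) ^ 2 := by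
    have h2 : (u * p - v * q⁻¹) * (u * q - v * p⁻¹) = (u * p - v * q⁻¹) ^ 2 * (q / p) := by
      field_simp
    rw [mul_assoc, h2]
    positivity
  have h3 : 2 * (u * p - v * q⁻¹) * (u * q - v * p⁻¹) =
      2 * u ^ 2 * p * q - 4 * u * v + 2 * v ^ 2 * p⁻¹ * q⁻¹ := by
    field_simp
    ring
  nlinarith [h1, h3]

/-- Integrating a pointwise bound against a symmetric Markov kernel. -/
lemma lintegral_markov_le {α : Type*} [MeasurableSpace α] {μ : Measure α} [SFinite μ]
    {F : α → ENNReal} {k A B D : α → α → ENNReal} (mF : Measurable F)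
    (mk : Measurable fun q : α × α => k q.1 q.2) (mA : Measurable fun q : α × α => A q.1 q.2)
    (mB : Measurable fun q : α × α => B q.1 q.2) (mD : Measurable fun q : α × α => D q.1 q.2)
    (ksymm : ∀ x x', k x x' = k x' x) (kone : ∀ x, ∫⁻ x', k x x' ∂μ = 1)
    (h : ∀ᵐ x ∂μ, ∀ᵐ x' ∂μ,
      F x * B x x' + 2 * F x + 2 * F x' ≤ 2 * D x x' + F x * A x x' + F x' * A x' x) :
    (∫⁻ x, ∫⁻ x', F x * B x x' * k x x' ∂μ ∂μ) + 2 * (∫⁻ x, F x ∂μ) + 2 * ∫⁻ x, F x ∂μ ≤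
      2 * (∫⁻ x, ∫⁻ x', D x x' * k x x' ∂μ ∂μ) +
        (∫⁻ x, F x * ∫⁻ x', A x x' * k x x' ∂μ ∂μ) +
        ∫⁻ x, F x * ∫⁻ x', A x x' * k x x' ∂μ ∂μ := by
  have mk1 : ∀ x, Measurable (k x) := fun x => mk.comp measurable_prodMk_left
  have mB1 : ∀ x, Measurable (B x) := fun x => mB.comp measurable_prodMk_left
  have mD1 : ∀ x, Measurable (D x) := fun x => mD.comp measurable_prodMk_left
  have mA1 : ∀ x, Measurable (A x) := fun x => mA.comp measurable_prodMk_left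
  have mA' : Measurable fun q : α × α => A q.2 q.1 := mA.comp measurable_swap
  have mA1' : ∀ x, Measurable (fun x' => A x' x) := fun x => mA.comp measurable_prodMk_right
  have hpt : ∀ᵐ x ∂μ, ∀ᵐ x' ∂μ,
      F x * B x x' * k x x' + 2 * (F x * k x x') + 2 * (F x' * k x x') ≤
      2 * (D x x' * k x x') + F x * (A x x' * k x x') + F x' * (A x' x * k x x') := by
    filter_upwards [h] with x hx
    filter_upwards [hx] with x' h2
    calc _ = (F x * B x x' + 2 * F x + 2 * F x') * k x x' := by ring
      _ ≤ (2 * D x x' + F x * A x x' + F x' * A x' x) * k x x' := by gcongr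
      _ = _ := by ring
  have h_int := lintegral_mono_ae (hpt.mono fun x hx => lintegral_mono_ae hx)
  have swapF : ∀ G : α → α → ENNReal, Measurable (fun q : α × α => G q.1 q.2) →
      ∫⁻ x, ∫⁻ x', F x' * (G x' x * k x x') ∂μ ∂μ =
        ∫⁻ x, F x * ∫⁻ x', G x x' * k x x' ∂μ ∂μ := by
    intro G mG
    rw [lintegral_lintegral_swap]
    · congr 1 with x
      rw [← lintegral_const_mul]
      · congr 1 with x'
        rw [ksymm]
      · exact (mG.comp measurable_prodMk_left).mul (mk1 x)
    · apply Measurable.aemeasurable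
      simp only [Function.uncurry_def]
      exact (mF.comp measurable_snd).mul ((mG.comp measurable_swap).mul mk)
  have s1 : ∫⁻ x, ∫⁻ x', F x' * k x x' ∂μ ∂μ = ∫⁻ x, F x ∂μ := by
    have := swapF (fun _ _ => 1) measurable_const
    simpa [kone] using this
  have s2 := swapF A mA
  have s3 : ∫⁻ x, ∫⁻ x', F x * k x x' ∂μ ∂μ = ∫⁻ x, F x ∂μ := by
    congr 1 with x
    rw [lintegral_const_mul _ (mk1 x), kone, mul_one]
  have s4 : ∫⁻ x, ∫⁻ x', F x * (A x x' * k x x') ∂μ ∂μ =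
      ∫⁻ x, F x * ∫⁻ x', A x x' * k x x' ∂μ ∂μ := by
    congr 1 with x
    rw [lintegral_const_mul _ (by fun_prop)]
  have e1 : ∫⁻ x, ∫⁻ x', F x * B x x' * k x x' + 2 * (F x * k x x') + 2 * (F x' * k x x') ∂μ ∂μ =
      (∫⁻ x, ∫⁻ x', F x * B x x' * k x x' ∂μ ∂μ) +
        2 * (∫⁻ x, ∫⁻ x', F x * k x x' ∂μ ∂μ) + 2 * ∫⁻ x, ∫⁻ x', F x' * k x x' ∂μ ∂μ := by
    rw [← lintegral_const_mul _ (Measurable.lintegral_prod_right' (f := fun q : α × α =>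
        F q.1 * k q.1 q.2) (by fun_prop)),
      ← lintegral_const_mul _ (Measurable.lintegral_prod_right' (f := fun q : α × α =>
        F q.2 * k q.1 q.2) (by fun_prop)),
      ← lintegral_add_left (Measurable.lintegral_prod_right' (f := fun q : α × α =>
        F q.1 * B q.1 q.2 * k q.1 q.2) (by fun_prop)),
      ← lintegral_add_right _ ((Measurable.lintegral_prod_right'
        (f := fun q : α × α => F q.2 * k q.1 q.2) (by fun_prop)).const_mul 2)]
    congr 1 with x
    rw [lintegral_add_right _ (by fun_prop), lintegral_add_right _ (by fun_prop),
      lintegral_const_mul _ (by fun_prop), lintegral_const_mul _ (by fun_prop),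
      lintegral_const_mul _ (by fun_prop)]
  have e2 : ∫⁻ x, ∫⁻ x', 2 * (D x x' * k x x') + F x * (A x x' * k x x') +
      F x' * (A x' x * k x x') ∂μ ∂μ = 2 * (∫⁻ x, ∫⁻ x', D x x' * k x x' ∂μ ∂μ) +
        (∫⁻ x, ∫⁻ x', F x * (A x x' * k x x') ∂μ ∂μ) +
        ∫⁻ x, ∫⁻ x', F x' * (A x' x * k x x') ∂μ ∂μ := by
    rw [← lintegral_const_mul _ (Measurable.lintegral_prod_right' (f := fun q : α × α =>
        D q.1 q.2 * k q.1 q.2) (by fun_prop)),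
      ← lintegral_add_right _ (Measurable.lintegral_prod_right' (f := fun q : α × α =>
        F q.1 * (A q.1 q.2 * k q.1 q.2)) (by fun_prop)),
      ← lintegral_add_right _ (Measurable.lintegral_prod_right'
        (f := fun q : α × α => F q.2 * (A q.2 q.1 * k q.1 q.2)) (by fun_prop))]
    congr 1 with x
    rw [lintegral_add_right _ (by fun_prop), lintegral_add_right _ (by fun_prop),
      lintegral_const_mul _ (by fun_prop)]
  rwa [e1, e2, s1, s2, s3, s4] at h_int

lemma two_pole_heat {d : ℕ} (hd : 0 < d) {s t : ℝ} (hs : s ∈ Set.Ioo (0:ℝ) 1)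
    (hds : (4:ℝ) - 2*s ≤ (d:ℝ)) (ht : 0 < t) (y z : Euc d) {f : Euc d → ℝ} (hf : Measurable f)
    (hfin : ∫⁻ x, ENNReal.ofReal (f x ^ 2) ≠ ⊤) :
    (∫⁻ x, ∫⁻ x', ENNReal.ofReal (f x ^ 2) *
        ENNReal.ofReal ((poleRatio d s y x x' - poleRatio d s z x x') ^ 2) *
        ENNReal.ofReal (heatKernel d t (x - x'))) +
      2 * ∫⁻ x, ENNReal.ofReal (f x ^ 2) * (heatDefect d s t (x - y) + heatDefect d s t (x - z)) ≤
    2 * ∫⁻ x, ∫⁻ x', ENNReal.ofReal ((f x - f x') ^ 2) *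
        ENNReal.ofReal (heatKernel d t (x - x')) := by
  have : Nonempty (Fin d) := ⟨⟨0, hd⟩⟩
  set F : Euc d → ENNReal := fun x => ENNReal.ofReal (f x ^ 2) with hF
  set k : Euc d → Euc d → ENNReal := fun x x' => ENNReal.ofReal (heatKernel d t (x - x')) with hk
  set A : Euc d → Euc d → ENNReal := fun x x' => ENNReal.ofReal (poleRatio d s y x x' ^ 2) +
    ENNReal.ofReal (poleRatio d s z x x' ^ 2) with hA
  set B : Euc d → Euc d → ENNReal := fun x x' =>
    ENNReal.ofReal ((poleRatio d s y x x' - poleRatio d s z x x') ^ 2) with hB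
  set D : Euc d → Euc d → ENNReal := fun x x' => ENNReal.ofReal ((f x - f x') ^ 2) with hD
  have mF : Measurable F := by fun_prop
  have mk : Measurable fun q : Euc d × Euc d => k q.1 q.2 := by fun_prop
  have mA : Measurable fun q : Euc d × Euc d => A q.1 q.2 := by fun_prop
  have mB : Measurable fun q : Euc d × Euc d => B q.1 q.2 := by fun_prop
  have mD : Measurable fun q : Euc d × Euc d => D q.1 q.2 := by fun_prop
  have h_int := lintegral_markov_le (μ := volume) mF mk mA mB mD
    (fun x x' => by simp only [hk]; rw [← heatKernel_neg, neg_sub])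
    (fun x => by
      simp only [hk]
      rw [lintegral_sub_left_eq_self (fun x' => ENNReal.ofReal (heatKernel d t x')),
        lintegral_heatKernel ht]) (by
    filter_upwards [Measure.ae_ne volume y, Measure.ae_ne volume z] with x hxy hxz
    filter_upwards [Measure.ae_ne volume y, Measure.ae_ne volume z] with x' hxy' hxz'
    have h1 := two_pole_pointwise (f x) (f x') (poleRatio_pos (s := s) hxy hxy')
      (poleRatio_pos (s := s) hxz hxz')
    simp only [hF, hA, hB, hD, poleRatio_swap (s := s) _ x x', ← ENNReal.ofReal_ofNat 2]
    rw [← ENNReal.ofReal_add (by positivity) (by positivity),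
      ← ENNReal.ofReal_add (by positivity) (by positivity)]
    simp only [← ENNReal.ofReal_mul (sq_nonneg _), ← ENNReal.ofReal_mul zero_le_two]
    rw [← ENNReal.ofReal_add (by positivity) (by positivity),
      ← ENNReal.ofReal_add (by positivity) (by positivity),
      ← ENNReal.ofReal_add (by positivity) (by positivity),
      ← ENNReal.ofReal_add (by positivity) (by positivity)]
    exact ENNReal.ofReal_le_ofReal h1)
  have s5 : (∫⁻ x, F x * (heatDefect d s t (x - y) + heatDefect d s t (x - z))) +
      ∫⁻ x, F x * ∫⁻ x', A x x' * k x x' = 2 * ∫⁻ x, F x := by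
    rw [← lintegral_add_left (by fun_prop), ← lintegral_const_mul _ mF]
    apply lintegral_congr_ae
    filter_upwards [Measure.ae_ne volume y, Measure.ae_ne volume z] with x hxy hxz
    have h1 := heatDefect_add_lintegral hd hs hds ht hxy
    have h2 := heatDefect_add_lintegral hd hs hds ht hxz
    rw [← mul_add, mul_comm]
    congr 1
    simp only [hA, add_mul]
    rw [lintegral_add_left (by fun_prop), add_add_add_comm, h1, h2, one_add_one_eq_two]
  set S := ∫⁻ x, F x * ∫⁻ x', A x x' * k x x'
  set H := ∫⁻ x, F x * (heatDefect d s t (x - y) + heatDefect d s t (x - z))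
  set I := ∫⁻ x, F x
  have h4 : (2 * I + 2 * I : ENNReal) ≠ ⊤ := by finiteness
  refine (ENNReal.add_le_add_iff_right h4).1 ?_
  calc _ = ((∫⁻ x, ∫⁻ x', F x * B x x' * k x x') + 2 * I + 2 * I) + 2 * H := by ring
    _ ≤ (2 * (∫⁻ x, ∫⁻ x', D x x' * k x x') + S + S) + 2 * H := by gcongr
    _ = 2 * (∫⁻ x, ∫⁻ x', D x x' * k x x') + ((H + S) + (H + S)) := by ring
    _ = _ := by rw [s5]

lemma lintegral_rpow_mul_lintegral_heatKernel {d : ℕ} (hd : 0 < d) {s : ℝ} (hs : 0 < s)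
    {G : Euc d → Euc d → ENNReal} (mG : Measurable fun q : Euc d × Euc d => G q.1 q.2) :
    ∫⁻ t in Ioi (0 : ℝ), ENNReal.ofReal (t ^ (-1 - s)) *
        ∫⁻ x, ∫⁻ x', G x x' * ENNReal.ofReal (heatKernel d t (x - x')) =
      ENNReal.ofReal (rieszConst d (-s)) *
        ∫⁻ x, ∫⁻ x', G x x' * ENNReal.ofReal (‖x - x'‖ ^ (-((d : ℝ) + 2 * s))) := by
  have : Nonempty (Fin d) := ⟨⟨0, hd⟩⟩
  have hR : 0 < rieszConst d (-s) := rieszConst_pos (by have : (0:ℝ) ≤ d := by positivity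
                                                        linarith)
  have h1 : ∀ t : ℝ, ENNReal.ofReal (t ^ (-1 - s)) *
      ∫⁻ x, ∫⁻ x', G x x' * ENNReal.ofReal (heatKernel d t (x - x')) =
      ∫⁻ q : Euc d × Euc d, ENNReal.ofReal (t ^ (-1 - s)) *
        (G q.1 q.2 * ENNReal.ofReal (heatKernel d t (q.1 - q.2))) := by
    intro t
    rw [lintegral_const_mul _ (by fun_prop), Measure.volume_eq_prod, lintegral_prod]
    fun_prop
  simp only [h1]
  rw [lintegral_lintegral_swap (by fun_prop), Measure.volume_eq_prod, lintegral_prod _ (by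
    refine (Measurable.lintegral_prod_right' (f := fun q : (Euc d × Euc d) × ℝ =>
      ENNReal.ofReal (q.2 ^ (-1 - s)) *
        (G q.1.1 q.1.2 * ENNReal.ofReal (heatKernel d q.2 (q.1.1 - q.1.2)))) ?_).aemeasurable
    have mG' : Measurable fun q : (Euc d × Euc d) × ℝ => G q.1.1 q.1.2 := mG.comp measurable_fst
    fun_prop)]
  rw [← lintegral_const_mul _ (Measurable.lintegral_prod_right' (f := fun q : Euc d × Euc d =>
    G q.1 q.2 * ENNReal.ofReal (‖q.1 - q.2‖ ^ (-((d : ℝ) + 2 * s)))) (by fun_prop))]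
  congr 1 with x
  have mG1 : Measurable (G x) := mG.comp measurable_prodMk_left
  rw [← lintegral_const_mul _ (by fun_prop)]
  apply lintegral_congr_ae
  filter_upwards [Measure.ae_ne volume x] with x' hx
  have h2 := lintegral_rpow_mul_heatKernel (d := d) (β := -s) (x := x - x')
    (by have : (0:ℝ) ≤ d := by positivity
        linarith) (sub_ne_zero.2 (Ne.symm hx))
  rw [show -s - 1 = -1 - s by ring, show 2 * -s - (d : ℝ) = -((d : ℝ) + 2 * s) by ring,
    ENNReal.ofReal_mul hR.le] at h2
  simp only [mul_left_comm _ (G x x')]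
  rw [lintegral_const_mul _ (by fun_prop), h2]

/-- The two-pole fractional Hardy inequality with its remainder. -/
lemma two_pole_hardy {d : ℕ} (hd : 0 < d) {s : ℝ} (hs : s ∈ Set.Ioo (0:ℝ) 1)
    (hds : (4:ℝ) - 2*s ≤ (d:ℝ)) (y z : Euc d) {f : Euc d → ℝ} (hf : Measurable f)
    (hfin : ∫⁻ x, ENNReal.ofReal (f x ^ 2) ≠ ⊤) :
    ENNReal.ofReal (a_sd d s / 2) * (∫⁻ x, ∫⁻ x', ENNReal.ofReal (f x ^ 2) *
        ENNReal.ofReal ((poleRatio d s y x x' - poleRatio d s z x x') ^ 2) *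
        ENNReal.ofReal (‖x - x'‖ ^ (-((d : ℝ) + 2 * s)))) +
      ENNReal.ofReal (C_fH d s / 2) * ∫⁻ x, ENNReal.ofReal (f x ^ 2) *
        (ENNReal.ofReal (‖x - y‖ ^ (-(2 * s))) + ENNReal.ofReal (‖x - z‖ ^ (-(2 * s)))) ≤
    ENNReal.ofReal (a_sd d s) * ∫⁻ x, ∫⁻ x', ENNReal.ofReal ((f x - f x') ^ 2) *
        ENNReal.ofReal (‖x - x'‖ ^ (-((d : ℝ) + 2 * s))) := by
  have : Nonempty (Fin d) := ⟨⟨0, hd⟩⟩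
  have hC := C_fH_pos (d := d) hs.1 (by linarith [hs.2])
  have ha := a_sd_pos (d := d) hs
  have hR := rieszConst_neg (d := d) hs
  have hg : 0 < Real.Gamma (1 - s) / s :=
    div_pos (Real.Gamma_pos_of_pos (by linarith [hs.2])) hs.1
  have h1 := setLIntegral_mono' (μ := volume) measurableSet_Ioi fun t (ht : t ∈ Ioi (0:ℝ)) =>
    mul_le_mul_right (two_pole_heat hd hs hds ht y z hf hfin) (ENNReal.ofReal (t ^ (-1 - s)))
  simp only [mul_add, mul_left_comm _ (2 : ENNReal)] at h1
  rw [lintegral_const_mul' _ _ (by finiteness),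
    lintegral_rpow_mul_lintegral_heatKernel hd hs.1 (by fun_prop)] at h1
  replace h1 := (le_lintegral_add _ _).trans h1
  rw [lintegral_rpow_mul_lintegral_heatKernel hd hs.1 (by fun_prop),
    lintegral_const_mul' _ _ (by finiteness)] at h1
  have h2 : ∫⁻ t in Ioi (0:ℝ), ENNReal.ofReal (t ^ (-1 - s)) *
      ∫⁻ x, (ENNReal.ofReal (f x ^ 2) * heatDefect d s t (x - y) +
        ENNReal.ofReal (f x ^ 2) * heatDefect d s t (x - z)) =
      ENNReal.ofReal (Real.Gamma (1 - s) / s * C_fH d s) * ∫⁻ x, ENNReal.ofReal (f x ^ 2) *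
        (ENNReal.ofReal (‖x - y‖ ^ (-(2 * s))) + ENNReal.ofReal (‖x - z‖ ^ (-(2 * s)))) := by
    simp only [← lintegral_const_mul' _ _ ENNReal.ofReal_ne_top]
    rw [lintegral_lintegral_swap (by fun_prop)]
    apply lintegral_congr_ae
    filter_upwards [Measure.ae_ne volume y, Measure.ae_ne volume z] with x hy hz
    have e1 := lintegral_rpow_mul_heatDefect (d := d) hs hds (sub_ne_zero.2 hy)
    have e2 := lintegral_rpow_mul_heatDefect (d := d) hs hds (sub_ne_zero.2 hz)
    rw [ENNReal.ofReal_mul (by positivity)] at e1 e2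
    simp only [← mul_add, mul_left_comm _ (ENNReal.ofReal (f x ^ 2))]
    rw [lintegral_const_mul' _ _ ENNReal.ofReal_ne_top]
    simp only [mul_add]
    rw [lintegral_add_left (by fun_prop), e1, e2, mul_add]
  rw [h2, hR] at h1
  set g := Real.Gamma (1 - s) / s
  generalize (∫⁻ x, ∫⁻ x', ENNReal.ofReal (f x ^ 2) *
        ENNReal.ofReal ((poleRatio d s y x x' - poleRatio d s z x x') ^ 2) *
        ENNReal.ofReal (‖x - x'‖ ^ (-((d : ℝ) + 2 * s)))) = I at h1 ⊢
  generalize (∫⁻ x, ENNReal.ofReal (f x ^ 2) *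
    (ENNReal.ofReal (‖x - y‖ ^ (-(2 * s))) + ENNReal.ofReal (‖x - z‖ ^ (-(2 * s))))) = V at h1 ⊢
  generalize (∫⁻ x, ∫⁻ x', ENNReal.ofReal ((f x - f x') ^ 2) *
        ENNReal.ofReal (‖x - x'‖ ^ (-((d : ℝ) + 2 * s)))) = D at h1 ⊢
  have h3 := mul_le_mul_right h1 (ENNReal.ofReal (1 / (4 * g)))
  rw [mul_add, ← ENNReal.ofReal_ofNat 2] at h3
  simp only [← mul_assoc] at h3
  simp only [← ENNReal.ofReal_mul (show 0 ≤ 1 / (4 * g) by positivity),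
    ← ENNReal.ofReal_mul (show 0 ≤ 1 / (4 * g) * 2 by positivity)] at h3
  convert h3 using 4
  all_goals first | rfl | (field_simp; try norm_num)

/-- The constant in front of the remainder of the two-pole inequality near a pole. -/
def remainderConst (d : ℕ) (s : ℝ) : ℝ :=
  ((16:ℝ) ^ (((d : ℝ) - 2 * s) / 4) - (4:ℝ) ^ (((d : ℝ) - 2 * s) / 4)) ^ 2 *
    (2:ℝ) ^ (-((d : ℝ) + 2 * s)) * ((16:ℝ) ^ d)⁻¹ *
    (volume (Metric.ball (0 : Euc d) 1)).toReal

lemma remainderConst_pos {d : ℕ} {s : ℝ} (hds : 2 * s < d) : 0 < remainderConst d s := by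
  have h1 : (4:ℝ) ^ (((d : ℝ) - 2 * s) / 4) < (16:ℝ) ^ (((d : ℝ) - 2 * s) / 4) :=
    Real.rpow_lt_rpow (by norm_num) (by norm_num) (by linarith)
  have h2 : 0 < (volume (Metric.ball (0 : Euc d) 1)).toReal :=
    ENNReal.toReal_pos (Metric.measure_ball_pos _ _ one_pos).ne' measure_ball_lt_top.ne
  have h3 := sub_pos.2 h1
  unfold remainderConst
  positivity

lemma poleRatio_remainder_pointwise {d : ℕ} {s : ℝ} (hs : 0 < s) (hds : 2 * s < d)
    {x x' y z : Euc d} (hxy : x ≠ y) (hz : ‖x - y‖ ≤ ‖y - z‖) (hx' : x' ≠ y)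
    (hb : ‖x' - y‖ < ‖x - y‖ / 16) :
    ((16:ℝ) ^ (((d : ℝ) - 2 * s) / 4) - (4:ℝ) ^ (((d : ℝ) - 2 * s) / 4)) ^ 2 *
      (2 * ‖x - y‖) ^ (-((d : ℝ) + 2 * s)) ≤
    (poleRatio d s y x x' - poleRatio d s z x x') ^ 2 * ‖x - x'‖ ^ (-((d : ℝ) + 2 * s)) := by
  have hρ : 0 < ‖x - y‖ := norm_pos_iff.2 (sub_ne_zero.2 hxy)
  have hr : 0 < ‖x' - y‖ := norm_pos_iff.2 (sub_ne_zero.2 hx')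
  have e1 : ‖x - z‖ ≤ ‖x - y‖ + ‖y - z‖ := norm_sub_le_norm_sub_add_norm_sub x y z
  have e2 : ‖y - z‖ ≤ ‖y - x'‖ + ‖x' - z‖ := norm_sub_le_norm_sub_add_norm_sub y x' z
  have e3 : ‖x - x'‖ ≤ ‖x - y‖ + ‖y - x'‖ := norm_sub_le_norm_sub_add_norm_sub x y x'
  have e4 : ‖x - y‖ ≤ ‖x - x'‖ + ‖x' - y‖ := norm_sub_le_norm_sub_add_norm_sub x x' y
  rw [norm_sub_rev y x'] at e2 e3
  have h1 : (4:ℝ) ^ (((d : ℝ) - 2 * s) / 4) < (16:ℝ) ^ (((d : ℝ) - 2 * s) / 4) :=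
    Real.rpow_lt_rpow (by norm_num) (by norm_num) (by linarith)
  have hp : (16:ℝ) ^ (((d : ℝ) - 2 * s) / 4) ≤ poleRatio d s y x x' := by
    apply Real.rpow_le_rpow (by norm_num) _ (by linarith)
    rw [le_div_iff₀ hr]
    linarith
  have hq : poleRatio d s z x x' ≤ (4:ℝ) ^ (((d : ℝ) - 2 * s) / 4) := by
    apply Real.rpow_le_rpow (by positivity) _ (by linarith)
    rw [div_le_iff₀ (by linarith)]
    linarith
  refine mul_le_mul ?_ ?_ (by positivity) (by positivity)
  · exact pow_le_pow_left₀ (by linarith) (by linarith) 2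
  · exact Real.rpow_le_rpow_of_nonpos (by linarith) (by linarith) (by
      have : (0:ℝ) ≤ d := by positivity
      linarith)

lemma poleRatio_remainder_le {d : ℕ} {s : ℝ} (hs : 0 < s) (hds : 2 * s < d)
    {x y z : Euc d} (hxy : x ≠ y) (hz : ‖x - y‖ ≤ ‖y - z‖) :
    ENNReal.ofReal (remainderConst d s * ‖x - y‖ ^ (-(2 * s))) ≤
      ∫⁻ x', ENNReal.ofReal ((poleRatio d s y x x' - poleRatio d s z x x') ^ 2) *
        ENNReal.ofReal (‖x - x'‖ ^ (-((d : ℝ) + 2 * s))) := by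
  have hd : 0 < d := by
    have : (0:ℝ) < d := by linarith
    exact_mod_cast this
  have : Nonempty (Fin d) := ⟨⟨0, hd⟩⟩
  have hρ : 0 < ‖x - y‖ := norm_pos_iff.2 (sub_ne_zero.2 hxy)
  set b := ((16:ℝ) ^ (((d : ℝ) - 2 * s) / 4) - (4:ℝ) ^ (((d : ℝ) - 2 * s) / 4)) ^ 2 *
      (2 * ‖x - y‖) ^ (-((d : ℝ) + 2 * s)) with hb
  calc ENNReal.ofReal (remainderConst d s * ‖x - y‖ ^ (-(2 * s)))
      = ENNReal.ofReal b * volume (Metric.ball y (‖x - y‖ / 16)) := by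
        rw [Measure.addHaar_ball _ _ (by positivity),
          ← ENNReal.ofReal_toReal (a := volume (Metric.ball (0 : Euc d) 1)) measure_ball_lt_top.ne,
          ← ENNReal.ofReal_mul (by positivity), ← ENNReal.ofReal_mul (by positivity)]
        congr 1
        simp only [hb, remainderConst, finrank_euclideanSpace, Fintype.card_fin]
        rw [Real.mul_rpow (by norm_num) hρ.le, div_pow, ← Real.rpow_natCast ‖x - y‖ d,
          show -(2 * s) = -((d : ℝ) + 2 * s) + d by ring, Real.rpow_add hρ]
        field_simp
    _ = ∫⁻ _ in Metric.ball y (‖x - y‖ / 16), ENNReal.ofReal b := by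
        rw [setLIntegral_const]
    _ ≤ ∫⁻ x' in Metric.ball y (‖x - y‖ / 16),
          ENNReal.ofReal ((poleRatio d s y x x' - poleRatio d s z x x') ^ 2) *
            ENNReal.ofReal (‖x - x'‖ ^ (-((d : ℝ) + 2 * s))) := by
        apply lintegral_mono_ae
        filter_upwards [ae_restrict_mem measurableSet_ball,
          ae_restrict_of_ae (Measure.ae_ne volume y)] with x' h1 h2
        rw [← ENNReal.ofReal_mul (by positivity)]
        exact ENNReal.ofReal_le_ofReal (poleRatio_remainder_pointwise hs hds hxy hz h2
          (by rwa [mem_ball_iff_norm] at h1))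
    _ ≤ _ := setLIntegral_le_lintegral _ _

/-- The two-pole fractional Hardy inequality with an explicit remainder at the first pole. -/
lemma two_pole_hardy_remainder {d : ℕ} (hd : 0 < d) {s : ℝ} (hs : s ∈ Set.Ioo (0:ℝ) 1)
    (hds : (4:ℝ) - 2*s ≤ (d:ℝ)) (y z : Euc d) {f : Euc d → ℝ} (hf : Measurable f)
    (hfin : ∫⁻ x, ENNReal.ofReal (f x ^ 2) ≠ ⊤) :
    ∫⁻ x, ENNReal.ofReal (f x ^ 2 * (C_fH d s / 2 * (‖x - y‖ ^ (-(2 * s)) + ‖x - z‖ ^ (-(2 * s))) +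
        a_sd d s / 2 * remainderConst d s *
          if ‖x - y‖ ≤ ‖y - z‖ then ‖x - y‖ ^ (-(2 * s)) else 0)) ≤
    ENNReal.ofReal (a_sd d s) * ∫⁻ x, ∫⁻ x', ENNReal.ofReal ((f x - f x') ^ 2) *
        ENNReal.ofReal (‖x - x'‖ ^ (-((d : ℝ) + 2 * s))) := by
  have : Nonempty (Fin d) := ⟨⟨0, hd⟩⟩
  have hds' : 2 * s < d := by linarith [hs.2]
  have hC := C_fH_pos (d := d) hs.1 hds'
  have ha := a_sd_pos (d := d) hs
  have hc := remainderConst_pos hds'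
  refine le_trans ?_ (two_pole_hardy hd hs hds y z hf hfin)
  rw [← lintegral_const_mul' _ _ ENNReal.ofReal_ne_top, ← lintegral_const_mul' _ _
    ENNReal.ofReal_ne_top, ← lintegral_add_right _ (by fun_prop)]
  apply lintegral_mono_ae
  filter_upwards [Measure.ae_ne volume y] with x hx
  simp only [mul_assoc (ENNReal.ofReal (f x ^ 2))]
  rw [lintegral_const_mul' _ _ ENNReal.ofReal_ne_top]
  have key : ENNReal.ofReal (remainderConst d s *
      if ‖x - y‖ ≤ ‖y - z‖ then ‖x - y‖ ^ (-(2 * s)) else 0) ≤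
      ∫⁻ x', ENNReal.ofReal ((poleRatio d s y x x' - poleRatio d s z x x') ^ 2) *
        ENNReal.ofReal (‖x - x'‖ ^ (-((d : ℝ) + 2 * s))) := by
    split_ifs with h
    · exact poleRatio_remainder_le hs.1 hds' hx h
    · simp
  have h0 : 0 ≤ (if ‖x - y‖ ≤ ‖y - z‖ then ‖x - y‖ ^ (-(2 * s)) else 0) := by positivity
  calc _ = ENNReal.ofReal (a_sd d s / 2) * (ENNReal.ofReal (f x ^ 2) *
          ENNReal.ofReal (remainderConst d s *
            if ‖x - y‖ ≤ ‖y - z‖ then ‖x - y‖ ^ (-(2 * s)) else 0)) +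
        ENNReal.ofReal (C_fH d s / 2) * (ENNReal.ofReal (f x ^ 2) *
          (ENNReal.ofReal (‖x - y‖ ^ (-(2 * s))) + ENNReal.ofReal (‖x - z‖ ^ (-(2 * s))))) := by
        rw [← ENNReal.ofReal_add (by positivity) (by positivity),
          ← ENNReal.ofReal_mul (by positivity), ← ENNReal.ofReal_mul (by positivity),
          ← ENNReal.ofReal_mul (by positivity), ← ENNReal.ofReal_mul (by positivity),
          ← ENNReal.ofReal_add (by positivity) (by positivity)]
        congr 1
        ring
    _ ≤ _ := by gcongr

/-- The extended-real Gagliardo energy of the `i`-th particle. -/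
def particleEnergy {d N : ℕ} (s : ℝ) (u : (Fin N → Euc d) → ℝ) (i : Fin N) : ENNReal :=
  ∫⁻ x : Fin N → Euc d, ∫⁻ z : Euc d,
    ENNReal.ofReal ((u x - u (Function.update x i z)) ^ 2 / ‖x i - z‖ ^ ((d : ℝ) + 2 * s))

/-- The weight gained by a particle at `x` against poles at `y` and `z`. -/
def twoPoleWeight (d : ℕ) (s : ℝ) (x y z : Euc d) : ℝ :=
  C_fH d s / 2 * (‖x - y‖ ^ (-(2 * s)) + ‖x - z‖ ^ (-(2 * s))) +
    a_sd d s / 2 * remainderConst d s *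
      if ‖x - y‖ ≤ ‖y - z‖ then ‖x - y‖ ^ (-(2 * s)) else 0

@[fun_prop]
lemma Measurable.twoPoleWeight {γ : Type*} [MeasurableSpace γ] {d : ℕ} {s : ℝ}
    {f g h : γ → Euc d} (hf : Measurable f) (hg : Measurable g) (hh : Measurable h) :
    Measurable fun a => twoPoleWeight d s (f a) (g a) (h a) := by
  unfold _root_.twoPoleWeight
  have : Measurable fun a => if ‖f a - g a‖ ≤ ‖g a - h a‖ then ‖f a - g a‖ ^ (-(2 * s)) else 0 :=
    Measurable.ite (measurableSet_le (by fun_prop) (by fun_prop)) (by fun_prop) measurable_const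
  fun_prop

@[fun_prop]
lemma Measurable.update {γ : Type*} [MeasurableSpace γ] {d N : ℕ} {i : Fin N}
    {f : γ → Fin N → Euc d} {g : γ → Euc d} (hf : Measurable f) (hg : Measurable g) :
    Measurable fun a => Function.update (f a) i (g a) :=
  measurable_update'.comp (hf.prodMk hg)

lemma HasCompactSupport.comp_update {d N : ℕ} {u : (Fin N → Euc d) → ℝ}
    (hu : HasCompactSupport u) (x : Fin N → Euc d) (i : Fin N) :
    HasCompactSupport fun y => u (Function.update x i y) := by
  refine HasCompactSupport.intro (hu.isCompact.image (continuous_apply i)) fun y hy => ?_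
  by_contra h
  exact hy ⟨Function.update x i y, subset_tsupport u h, by simp⟩

lemma lintegral_twoPoleWeight_le {d N : ℕ} (hd : 0 < d) {s : ℝ} (hs : s ∈ Set.Ioo (0:ℝ) 1)
    (hds : (4:ℝ) - 2*s ≤ (d:ℝ)) {u : (Fin N → Euc d) → ℝ} (hu : Continuous u)
    (hc : HasCompactSupport u) {i j k : Fin N} (hij : i ≠ j) (hik : i ≠ k) :
    ∫⁻ x, ENNReal.ofReal (u x ^ 2 * twoPoleWeight d s (x i) (x j) (x k)) ≤
      ENNReal.ofReal (a_sd d s) * particleEnergy s u i := by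
  have mu := hu.measurable
  rw [particleEnergy, ← lintegral_const_mul' _ _ ENNReal.ofReal_ne_top, volume_pi]
  have mG : Measurable fun x : Fin N → Euc d => ∫⁻ z : Euc d, ENNReal.ofReal
      ((u x - u (Function.update x i z)) ^ 2 / ‖x i - z‖ ^ ((d : ℝ) + 2 * s)) :=
    Measurable.lintegral_prod_right' (f := fun q : (Fin N → Euc d) × Euc d => ENNReal.ofReal
      ((u q.1 - u (Function.update q.1 i q.2)) ^ 2 / ‖q.1 i - q.2‖ ^ ((d : ℝ) + 2 * s)))
      (by fun_prop)
  refine lintegral_le_of_lmarginal_le {i} (by fun_prop) (mG.const_mul _) ?_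
  rw [lmarginal_singleton, lmarginal_singleton]
  intro x
  have h1 := two_pole_hardy_remainder hd hs hds (x j) (x k)
    (f := fun y => u (Function.update x i y)) (by fun_prop) (by
      have h2 : Continuous fun y => u (Function.update x i y) := by fun_prop
      refine (Integrable.lintegral_lt_top (Continuous.integrable_of_hasCompactSupport
        (by fun_prop) ?_)).ne
      exact (hc.comp_update x i).comp_left (g := fun r : ℝ => r ^ 2) (by simp))
  rw [← lintegral_const_mul' _ _ ENNReal.ofReal_ne_top] at h1
  convert h1 using 1
  · simp [twoPoleWeight, hij.symm, hik.symm]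
  · simp only [Function.update_self, Function.update_idem]
    congr! 5 with y z
    rw [← ENNReal.ofReal_mul (by positivity), Real.rpow_neg (by positivity), div_eq_mul_inv]

lemma lintegral_min_norm_sq_lt_top {d : ℕ} (hd : 0 < d) {s : ℝ} (hs : s ∈ Set.Ioo (0:ℝ) 1)
    {A B : ℝ} (hA : 0 ≤ A) (hB : 0 ≤ B) :
    ∫⁻ x : Euc d, ENNReal.ofReal (min (A * ‖x‖ ^ 2) B * ‖x‖ ^ (-((d : ℝ) + 2 * s))) < ⊤ := by
  have : Nonempty (Fin d) := ⟨⟨0, hd⟩⟩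
  obtain ⟨hs0, hs1⟩ := hs
  refine Integrable.lintegral_lt_top ?_
  rw [integrable_fun_norm_addHaar volume
    (f := fun r : ℝ => min (A * r ^ 2) B * r ^ (-((d : ℝ) + 2 * s)))]
  simp only [finrank_euclideanSpace, Fintype.card_fin, smul_eq_mul]
  have hm : Measurable fun r : ℝ =>
      r ^ (d - 1) * (min (A * r ^ 2) B * r ^ (-((d : ℝ) + 2 * s))) := by fun_prop
  have hpow : ∀ r : ℝ, 0 < r → r ^ (d - 1) * r ^ (-((d : ℝ) + 2 * s)) = r ^ (-1 - 2 * s) := by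
    intro r hr
    rw [← Real.rpow_natCast, ← Real.rpow_add hr, Nat.cast_sub hd]
    congr 1
    push_cast
    ring
  have h1 : IntegrableOn (fun r : ℝ => A * r ^ (1 - 2 * s)) (Ioc 0 1) := by
    have := (intervalIntegral.intervalIntegrable_rpow' (a := 0) (b := 1) (r := 1 - 2 * s)
      (by linarith)).1
    exact this.const_mul A
  have h2 : IntegrableOn (fun r : ℝ => B * r ^ (-1 - 2 * s)) (Ioi 1) :=
    (integrableOn_Ioi_rpow_of_lt (by linarith) one_pos).const_mul B
  rw [← Ioc_union_Ioi_eq_Ioi (zero_le_one' ℝ)]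
  refine IntegrableOn.union ?_ ?_
  · refine h1.mono' hm.aestronglyMeasurable ?_
    filter_upwards [ae_restrict_mem measurableSet_Ioc] with r hr
    have hr0 : 0 < r := hr.1
    have h0 : 0 ≤ min (A * r ^ 2) B := le_min (by positivity) hB
    rw [Real.norm_of_nonneg (by positivity), mul_left_comm, hpow r hr0]
    calc _ ≤ A * r ^ 2 * r ^ (-1 - 2 * s) := by gcongr; exact min_le_left _ _
      _ = _ := by
        rw [mul_assoc, ← Real.rpow_natCast r 2, ← Real.rpow_add hr0]
        congr 2
        push_cast
        ring
  · refine h2.mono' hm.aestronglyMeasurable ?_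
    filter_upwards [ae_restrict_mem measurableSet_Ioi] with r hr
    have hr0 : 0 < r := one_pos.trans hr
    have h0 : 0 ≤ min (A * r ^ 2) B := le_min (by positivity) hB
    rw [Real.norm_of_nonneg (by positivity), mul_left_comm, hpow r hr0]
    gcongr
    exact min_le_right _ _

lemma lintegral_update_convolution {d N : ℕ} (i : Fin N) {H : (Fin N → Euc d) → ENNReal}
    (mH : Measurable H) {φ : Euc d → ENNReal} (mφ : Measurable φ) :
    ∫⁻ x : Fin N → Euc d, ∫⁻ z : Euc d, H (Function.update x i z) * φ (x i - z) =
      ∫⁻ x : Fin N → Euc d, H x * ∫⁻ z, φ z := by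
  rw [volume_pi]
  refine lintegral_eq_of_lmarginal_eq {i} (Measurable.lintegral_prod_right'
    (f := fun q : (Fin N → Euc d) × Euc d => H (Function.update q.1 i q.2) * φ (q.1 i - q.2))
    (by fun_prop)) (by fun_prop) ?_
  rw [lmarginal_singleton, lmarginal_singleton]
  ext x
  simp only [Function.update_self, Function.update_idem]
  rw [lintegral_lintegral_swap (by fun_prop)]
  congr 1 with z
  rw [lintegral_const_mul _ (by fun_prop), lintegral_sub_right_eq_self φ]

lemma particleEnergy_lt_top {d N : ℕ} (hd : 0 < d) {s : ℝ} (hs : s ∈ Set.Ioo (0:ℝ) 1)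
    {u : (Fin N → Euc d) → ℝ} (hu : ContDiff ℝ (⊤ : ℕ∞) u) (hc : HasCompactSupport u) (i : Fin N) :
    particleEnergy s u i < ⊤ := by
  obtain ⟨L, hL⟩ := ContDiff.lipschitzWith_of_hasCompactSupport hc hu (by simp)
  obtain ⟨M, hM⟩ := hu.continuous.bounded_above_of_compact_support hc
  have hM0 : 0 ≤ M := (norm_nonneg _).trans (hM 0)
  set φ : Euc d → ENNReal := fun h => ENNReal.ofReal
    (min ((L : ℝ) ^ 2 * ‖h‖ ^ 2) ((2 * M) ^ 2) * ‖h‖ ^ (-((d : ℝ) + 2 * s))) with hφ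
  have mφ : Measurable φ := by fun_prop
  have hφ_top : ∫⁻ z, φ z < ⊤ := lintegral_min_norm_sq_lt_top hd hs (by positivity) (by positivity)
  set H : (Fin N → Euc d) → ENNReal := (tsupport u).indicator 1 with hH
  have mH : Measurable H := measurable_one.indicator (isClosed_tsupport u).measurableSet
  have hH_top : ∫⁻ x, H x < ⊤ := by
    rw [hH, lintegral_indicator_one (isClosed_tsupport u).measurableSet]
    exact hc.isCompact.measure_lt_top
  have hpt : ∀ x z, ENNReal.ofReal
      ((u x - u (Function.update x i z)) ^ 2 / ‖x i - z‖ ^ ((d : ℝ) + 2 * s)) ≤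
      H x * φ (x i - z) + H (Function.update x i z) * φ (x i - z) := by
    intro x z
    by_cases h : x ∈ tsupport u ∨ Function.update x i z ∈ tsupport u
    · have h1 : 1 ≤ H x + H (Function.update x i z) := by
        rcases h with h | h <;> simp [hH, indicator_of_mem h]
      rw [← add_mul]
      refine le_trans ?_ (mul_le_mul_left h1 _)
      rw [one_mul]
      apply ENNReal.ofReal_le_ofReal
      rw [Real.rpow_neg (norm_nonneg _), div_eq_mul_inv]
      gcongr
      refine le_min ?_ ?_
      · have h2 := hL.dist_le_mul x (Function.update x i z)
        have h3 : dist x (Function.update x i z) ≤ ‖x i - z‖ := by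
          rw [dist_pi_le_iff (norm_nonneg _)]
          intro k
          by_cases hk : k = i
          · subst hk
            simp [dist_eq_norm]
          · simp [hk]
        rw [← mul_pow, ← sq_abs]
        rw [Real.dist_eq] at h2
        gcongr
        exact h2.trans (by gcongr)
      · have h2 := hM x
        have h3 := hM (Function.update x i z)
        rw [← sq_abs]
        gcongr
        refine (abs_sub _ _).trans ?_
        simp only [Real.norm_eq_abs] at h2 h3
        linarith
    · push Not at h
      simp [image_eq_zero_of_notMem_tsupport h.1, image_eq_zero_of_notMem_tsupport h.2]
  calc particleEnergy s u i
      ≤ ∫⁻ x : Fin N → Euc d, ∫⁻ z : Euc d,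
          (H x * φ (x i - z) + H (Function.update x i z) * φ (x i - z)) :=
        lintegral_mono fun x => lintegral_mono fun z => hpt x z
    _ = ∫⁻ x : Fin N → Euc d, (H x * (∫⁻ z, φ z) +
          ∫⁻ z : Euc d, H (Function.update x i z) * φ (x i - z)) := by
        congr 1 with x
        rw [lintegral_add_left (by fun_prop), lintegral_const_mul _ (by fun_prop),
          lintegral_sub_left_eq_self φ]
    _ = (∫⁻ x, H x) * (∫⁻ z, φ z) + (∫⁻ x, H x) * (∫⁻ z, φ z) := by
        rw [lintegral_add_left (by fun_prop), lintegral_update_convolution i mH mφ,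
          lintegral_mul_const _ mH]
    _ < ⊤ := by finiteness

lemma sum_ite_distinct {N : ℕ} (hN : 2 ≤ N) (i j : Fin N) (r : ℝ) :
    ∑ k : Fin N, (if i ≠ j ∧ i ≠ k ∧ j ≠ k then r else 0) =
      ((N : ℝ) - 2) * if i ≠ j then r else 0 := by
  by_cases h : i = j
  · simp [h]
  · have h1 : (Finset.univ.filter fun k => i ≠ j ∧ i ≠ k ∧ j ≠ k) = ({i, j} : Finset (Fin N))ᶜ := by
      ext k
      simp [h, eq_comm]
    rw [← Finset.sum_filter, h1, Finset.sum_const, Finset.card_compl, Finset.card_pair h,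
      Fintype.card_fin, nsmul_eq_mul, Nat.cast_sub hN]
    simp [h]

lemma sum_ite_ne {N : ℕ} (i : Fin N) (r : ℝ) :
    ∑ k : Fin N, (if i ≠ k then r else 0) = ((N : ℝ) - 1) * r := by
  have h1 : (Finset.univ.filter fun k => i ≠ k) = ({i} : Finset (Fin N))ᶜ := by
    ext k
    simp [eq_comm]
  rw [← Finset.sum_filter, h1, Finset.sum_const, Finset.card_compl, Finset.card_singleton,
    Fintype.card_fin, nsmul_eq_mul, Nat.cast_sub (by have := i.2; omega)]
  simp

lemma sum_ite_ne_eq_two_mul {N : ℕ} {P : Fin N → Fin N → ℝ} (hP : ∀ i j, P i j = P j i) :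
    ∑ i, ∑ j, (if i ≠ j then P i j else 0) = 2 * ∑ i, ∑ j, if i < j then P i j else 0 := by
  have h1 : ∀ i j, (if i ≠ j then P i j else 0) =
      (if i < j then P i j else 0) + if j < i then P j i else 0 := by
    intro i j
    rcases lt_trichotomy i j with h | h | h
    · simp [h, h.ne, h.not_gt]
    · simp [h]
    · simp [h, h.ne', h.not_gt, hP i j]
  simp only [h1, Finset.sum_add_distrib]
  rw [Finset.sum_comm (f := fun i j => if j < i then P j i else 0), two_mul]

/-- Averaging a three-particle bound over all triples. -/
lemma sum_pairs_le_sum {N : ℕ} (hN : 3 ≤ N) {e : Fin N → ℝ} {P : Fin N → Fin N → ℝ}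
    (hP : ∀ i j, P i j = P j i) {C c : ℝ}
    (h : ∀ i j k, i ≠ j → i ≠ k → j ≠ k →
      C / 2 * (P i j + 2 * P i k + P j k) + c * P i j ≤ e i + e k) :
    (2 * C + c) * ∑ i, ∑ j, (if i < j then P i j else 0) ≤ ((N : ℝ) - 1) * ∑ i, e i := by
  have hN' : (3:ℝ) ≤ N := by exact_mod_cast hN
  set D : Fin N → Fin N → Fin N → Prop := fun i j k => i ≠ j ∧ i ≠ k ∧ j ≠ k with hD
  have key : ∑ i, ∑ j, ∑ k, ((C / 2 + c) * (if D i j k then P i j else 0) +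
      C * (if D i k j then P i k else 0) + C / 2 * (if D j k i then P j k else 0)) ≤
      ∑ i, ∑ j, ∑ k, ((if D i j k then e i else 0) + if D k i j then e k else 0) := by
    refine Finset.sum_le_sum fun i _ => Finset.sum_le_sum fun j _ => Finset.sum_le_sum fun k _ => ?_
    by_cases hd : i ≠ j ∧ i ≠ k ∧ j ≠ k
    · have h1 := h i j k hd.1 hd.2.1 hd.2.2
      obtain ⟨h2, h3, h4⟩ := hd
      simp only [hD, ne_eq, h2, h3, h4, h2.symm, h3.symm, h4.symm, not_false_eq_true, and_self,
        if_true]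
      linarith
    · have h2 : ¬ D i j k := hd
      have h3 : ¬ D i k j := by simp only [hD]; tauto
      have h4 : ¬ D j k i := by simp only [hD]; tauto
      have h5 : ¬ D k i j := by simp only [hD]; tauto
      simp [h2, h3, h4, h5]
  set S := ∑ i, ∑ j, (if i ≠ j then P i j else 0) with hS
  have s1 : ∑ i, ∑ j, ∑ k, (if D i j k then P i j else 0) = ((N : ℝ) - 2) * S := by
    simp only [hD, sum_ite_distinct (by omega : 2 ≤ N), ← Finset.mul_sum, hS]
  have s2 : ∑ i, ∑ j, ∑ k, (if D i k j then P i k else 0) = ((N : ℝ) - 2) * S := by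
    rw [← s1]
    exact Finset.sum_congr rfl fun i _ => Finset.sum_comm
  have s3 : ∑ i, ∑ j, ∑ k, (if D j k i then P j k else 0) = ((N : ℝ) - 2) * S := by
    rw [← s1, Finset.sum_comm]
    exact Finset.sum_congr rfl fun i _ => Finset.sum_comm
  have s4 : ∑ i, ∑ j, ∑ k, (if D i j k then e i else 0) =
      ((N : ℝ) - 2) * (((N : ℝ) - 1) * ∑ i, e i) := by
    simp only [hD, sum_ite_distinct (by omega : 2 ≤ N), ← Finset.mul_sum, sum_ite_ne]
  have s5 : ∑ i, ∑ j, ∑ k, (if D k i j then e k else 0) =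
      ((N : ℝ) - 2) * (((N : ℝ) - 1) * ∑ i, e i) := by
    rw [← s4]
    calc _ = ∑ i, ∑ k, ∑ j, (if D k i j then e k else 0) :=
          Finset.sum_congr rfl fun i _ => Finset.sum_comm
      _ = _ := Finset.sum_comm
  simp only [Finset.sum_add_distrib, ← Finset.mul_sum] at key
  rw [s1, s2, s3, s4, s5, hS, sum_ite_ne_eq_two_mul hP] at key
  have h2 : (0:ℝ) < N - 2 := by linarith
  have h3 : ((N : ℝ) - 2) * ((2 * C + c) * ∑ i, ∑ j, (if i < j then P i j else 0)) ≤
      ((N : ℝ) - 2) * (((N : ℝ) - 1) * ∑ i, e i) := by linarith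
  exact le_of_mul_le_mul_left h3 h2

lemma twoPoleWeight_add_ge {d : ℕ} {s : ℝ} (hs : 0 < s) (ha : 0 ≤ a_sd d s)
    (hc : 0 ≤ remainderConst d s) {x y z : Euc d} (hyz : y ≠ z) :
    C_fH d s / 2 * (‖x - y‖ ^ (-(2 * s)) + 2 * ‖x - z‖ ^ (-(2 * s)) + ‖y - z‖ ^ (-(2 * s))) +
      a_sd d s / 2 * remainderConst d s * ‖x - y‖ ^ (-(2 * s)) ≤
    twoPoleWeight d s x y z + twoPoleWeight d s z y x := by
  have h0 : 0 ≤ a_sd d s / 2 * remainderConst d s := by positivity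
  have h1 : ‖x - y‖ ^ (-(2 * s)) ≤ (if ‖x - y‖ ≤ ‖y - z‖ then ‖x - y‖ ^ (-(2 * s)) else 0) +
      if ‖z - y‖ ≤ ‖y - x‖ then ‖z - y‖ ^ (-(2 * s)) else 0 := by
    rw [norm_sub_rev z y, norm_sub_rev y x]
    have hp : 0 < ‖y - z‖ := norm_pos_iff.2 (sub_ne_zero.2 hyz)
    split_ifs with h2 h3 h3
    · linarith [Real.rpow_nonneg hp.le (-(2 * s))]
    · simp
    · rw [zero_add]
      exact Real.rpow_le_rpow_of_nonpos hp h3 (by linarith)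
    · linarith
  have h2 := mul_le_mul_of_nonneg_left h1 h0
  unfold twoPoleWeight
  rw [norm_sub_rev z y, norm_sub_rev z x] at *
  linarith

lemma kinetic_eq_sum_particleEnergy {d N : ℕ} (hd : 0 < d) {s : ℝ} (hs : s ∈ Set.Ioo (0:ℝ) 1)
    {u : (Fin N → Euc d) → ℝ} (hu : ContDiff ℝ (⊤ : ℕ∞) u) (hc : HasCompactSupport u) :
    kinetic d N s u = ∑ i, a_sd d s * (particleEnergy s u i).toReal := by
  unfold kinetic
  refine Finset.sum_congr rfl fun i _ => ?_
  congr 1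
  have mu := hu.continuous.measurable
  have mf : Measurable fun q : (Fin N → Euc d) × Euc d =>
      (u q.1 - u (Function.update q.1 i q.2)) ^ 2 / ‖q.1 i - q.2‖ ^ ((d : ℝ) + 2 * s) := by
    fun_prop
  have hin : ∀ x : Fin N → Euc d,
      ∫ z : Euc d, (u x - u (Function.update x i z)) ^ 2 / ‖x i - z‖ ^ ((d : ℝ) + 2 * s) =
      (∫⁻ z : Euc d, ENNReal.ofReal
        ((u x - u (Function.update x i z)) ^ 2 / ‖x i - z‖ ^ ((d : ℝ) + 2 * s))).toReal := by
    intro x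
    exact integral_eq_lintegral_of_nonneg_ae (.of_forall fun z => by positivity)
      (mf.comp measurable_prodMk_left).aestronglyMeasurable
  simp only [hin]
  have mg := Measurable.lintegral_prod_right' (ν := (volume : Measure (Euc d)))
    mf.ennreal_ofReal
  rw [integral_toReal mg.aemeasurable (ae_lt_top mg (particleEnergy_lt_top hd hs hu hc i).ne)]
  rfl

section ParticleBounds

variable {d N : ℕ} {s : ℝ} {u : (Fin N → Euc d) → ℝ}

lemma twoPoleWeight_nonneg (hC : 0 ≤ C_fH d s) (ha : 0 ≤ a_sd d s) (hc : 0 ≤ remainderConst d s)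
    (x y z : Euc d) : 0 ≤ twoPoleWeight d s x y z := by
  unfold twoPoleWeight
  positivity

lemma integrable_sq_mul_twoPoleWeight (hd : 0 < d) (hs : s ∈ Set.Ioo (0:ℝ) 1)
    (hds : (4:ℝ) - 2*s ≤ (d:ℝ)) (hu : ContDiff ℝ (⊤ : ℕ∞) u) (hc : HasCompactSupport u)
    {i j k : Fin N} (hij : i ≠ j) (hik : i ≠ k) :
    Integrable (fun x => u x ^ 2 * twoPoleWeight d s (x i) (x j) (x k)) ∧
      ∫ x, u x ^ 2 * twoPoleWeight d s (x i) (x j) (x k) ≤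
        a_sd d s * (particleEnergy s u i).toReal := by
  have hds' : 2 * s < d := by linarith [hs.2]
  have ha := a_sd_pos (d := d) hs
  have h0 : ∀ x : Fin N → Euc d, 0 ≤ u x ^ 2 * twoPoleWeight d s (x i) (x j) (x k) := fun x =>
    mul_nonneg (sq_nonneg _) (twoPoleWeight_nonneg (C_fH_pos hs.1 hds').le ha.le
      (remainderConst_pos hds').le _ _ _)
  have mu := hu.continuous.measurable
  have hm : Measurable fun x => u x ^ 2 * twoPoleWeight d s (x i) (x j) (x k) := by fun_prop
  have hle := lintegral_twoPoleWeight_le hd hs hds hu.continuous hc hij hik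
  have htop : ENNReal.ofReal (a_sd d s) * particleEnergy s u i < ⊤ :=
    ENNReal.mul_lt_top ENNReal.ofReal_lt_top (particleEnergy_lt_top hd hs hu hc i)
  refine ⟨⟨hm.aestronglyMeasurable, ?_⟩, ?_⟩
  · rw [hasFiniteIntegral_iff_ofReal (.of_forall h0)]
    exact hle.trans_lt htop
  · rw [integral_eq_lintegral_of_nonneg_ae (.of_forall h0) hm.aestronglyMeasurable]
    refine (ENNReal.toReal_mono htop.ne hle).trans ?_
    rw [ENNReal.toReal_mul, ENNReal.toReal_ofReal ha.le]

lemma integrable_sq_mul_norm_rpow (hd : 0 < d) (hs : s ∈ Set.Ioo (0:ℝ) 1)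
    (hds : (4:ℝ) - 2*s ≤ (d:ℝ)) (hu : ContDiff ℝ (⊤ : ℕ∞) u) (hc : HasCompactSupport u)
    {i j : Fin N} (hij : i ≠ j) :
    Integrable fun x => u x ^ 2 * ‖x i - x j‖ ^ (-(2 * s)) := by
  have hds' : 2 * s < d := by linarith [hs.2]
  have hC := C_fH_pos (d := d) hs.1 hds'
  have ha := a_sd_pos (d := d) hs
  have hr := remainderConst_pos hds'
  have mu := hu.continuous.measurable
  have hm : Measurable fun x : Fin N → Euc d => u x ^ 2 * ‖x i - x j‖ ^ (-(2 * s)) := by fun_prop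
  refine ((integrable_sq_mul_twoPoleWeight hd hs hds hu hc hij hij).1.const_mul
    (2 / C_fH d s)).mono' hm.aestronglyMeasurable (.of_forall fun x => ?_)
  rw [Real.norm_of_nonneg (by positivity), mul_left_comm]
  gcongr
  have h1 : C_fH d s / 2 * ‖x i - x j‖ ^ (-(2 * s)) ≤ twoPoleWeight d s (x i) (x j) (x j) := by
    unfold twoPoleWeight
    rw [mul_add, add_assoc]
    exact le_add_of_nonneg_right (by positivity)
  calc _ = 2 / C_fH d s * (C_fH d s / 2 * ‖x i - x j‖ ^ (-(2 * s))) := by field_simp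
    _ ≤ _ := by gcongr

/-- The improved three-particle bound. -/
lemma three_particle_le (hd : 0 < d) (hs : s ∈ Set.Ioo (0:ℝ) 1)
    (hds : (4:ℝ) - 2*s ≤ (d:ℝ)) (hu : ContDiff ℝ (⊤ : ℕ∞) u) (hc : HasCompactSupport u)
    (hsupp : tsupport u ⊆ {x : Fin N → Euc d | ∀ i j, i ≠ j → x i ≠ x j})
    {i j k : Fin N} (hij : i ≠ j) (hik : i ≠ k) (hjk : j ≠ k) :
    C_fH d s / 2 * ((∫ x, u x ^ 2 * ‖x i - x j‖ ^ (-(2 * s))) +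
        2 * (∫ x, u x ^ 2 * ‖x i - x k‖ ^ (-(2 * s))) +
        ∫ x, u x ^ 2 * ‖x j - x k‖ ^ (-(2 * s))) +
      a_sd d s / 2 * remainderConst d s * (∫ x, u x ^ 2 * ‖x i - x j‖ ^ (-(2 * s))) ≤
    a_sd d s * (particleEnergy s u i).toReal + a_sd d s * (particleEnergy s u k).toReal := by
  have hds' : 2 * s < d := by linarith [hs.2]
  have h1 := integrable_sq_mul_twoPoleWeight hd hs hds hu hc hij hik
  have h2 := integrable_sq_mul_twoPoleWeight hd hs hds hu hc hjk.symm hik.symm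
  have i1 := integrable_sq_mul_norm_rpow hd hs hds hu hc hij
  have i2 := integrable_sq_mul_norm_rpow hd hs hds hu hc hik
  have i3 := integrable_sq_mul_norm_rpow hd hs hds hu hc hjk
  refine le_trans ?_ (add_le_add h1.2 h2.2)
  have i4 : Integrable fun x => u x ^ 2 * ‖x i - x j‖ ^ (-(2 * s)) +
      2 * (u x ^ 2 * ‖x i - x k‖ ^ (-(2 * s))) := i1.add (i2.const_mul 2)
  have i5 : Integrable fun x => C_fH d s / 2 * (u x ^ 2 * ‖x i - x j‖ ^ (-(2 * s)) +
      2 * (u x ^ 2 * ‖x i - x k‖ ^ (-(2 * s))) + u x ^ 2 * ‖x j - x k‖ ^ (-(2 * s))) :=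
    (i4.add i3).const_mul _
  rw [← integral_add h1.1 h2.1, ← integral_const_mul, ← integral_add i1 (i2.const_mul 2),
    ← integral_add i4 i3, ← integral_const_mul, ← integral_const_mul,
    ← integral_add i5 (i1.const_mul _)]
  refine integral_mono (i5.add (i1.const_mul _)) (h1.1.add h2.1) fun x => ?_
  by_cases hx : u x = 0
  · simp [hx]
  · have h3 := twoPoleWeight_add_ge hs.1 (a_sd_pos (d := d) hs).le (remainderConst_pos hds').le
      (x := x i) (hsupp (subset_tsupport u hx) j k hjk)
    have h4 := mul_le_mul_of_nonneg_left h3 (sq_nonneg (u x))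
    simp only
    linarith

end ParticleBounds

end Auxiliary

/-- **Corollary 3.4** (improved Coulomb-type constant for `N > d + 1`). -/
theorem improved_Coulomb_constant
    (d : ℕ) (hd : 0 < d) (s : ℝ) (hs : s ∈ Set.Ioo (0:ℝ) 1)
    (hds : (4:ℝ) - 2*s ≤ (d:ℝ)) (N : ℕ) (hN : 3 ≤ N) (hNd : d + 1 < N) :
    ∃ δ : ℝ, 0 < δ ∧
      ∀ u : (Fin N → Euc d) → ℝ,
        ContDiff ℝ (⊤ : ℕ∞) u → HasCompactSupport u →
        tsupport u ⊆ {x : Fin N → Euc d | ∀ i j, i ≠ j → x i ≠ x j} →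
        2 * C_fH d s / ((N:ℝ) - 1) * (1 + δ / ((N:ℝ) - 2)) *
          ∫ x : Fin N → Euc d,
            (∑ i : Fin N, ∑ j : Fin N,
              if i < j then 1/‖x i - x j‖^(2*s) else 0) * (u x)^2
          ≤ kinetic d N s u := by
  have hds' : 2 * s < d := by linarith [hs.2]
  have hC := C_fH_pos (d := d) hs.1 hds'
  have hr := remainderConst_pos hds'
  have ha := a_sd_pos (d := d) hs
  have hN' : (3:ℝ) ≤ N := by exact_mod_cast hN
  set c := a_sd d s / 2 * remainderConst d s with hc_def
  have hc : 0 < c := by positivity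
  have hN2 : (0:ℝ) < N - 2 := by linarith
  have hN1 : (0:ℝ) < N - 1 := by linarith
  refine ⟨(N - 2) * c / (2 * C_fH d s), by positivity, fun u hu hcs hsupp => ?_⟩
  set P : Fin N → Fin N → ℝ := fun i j => ∫ x, u x ^ 2 * ‖x i - x j‖ ^ (-(2 * s)) with hP
  have h_int : ∫ x : Fin N → Euc d, (∑ i : Fin N, ∑ j : Fin N,
      if i < j then 1/‖x i - x j‖^(2*s) else 0) * (u x)^2 =
      ∑ i, ∑ j, if i < j then P i j else 0 := by
    have e1 : ∀ x : Fin N → Euc d, (∑ i : Fin N, ∑ j : Fin N,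
        if i < j then 1/‖x i - x j‖^(2*s) else 0) * (u x)^2 =
        ∑ i : Fin N, ∑ j : Fin N, if i < j then u x ^ 2 * ‖x i - x j‖ ^ (-(2 * s)) else 0 := by
      intro x
      simp only [Finset.sum_mul, ite_mul, zero_mul, Real.rpow_neg (norm_nonneg _), one_div,
        mul_comm (u x ^ 2)]
    have e2 : ∀ i j : Fin N, Integrable fun x : Fin N → Euc d =>
        if i < j then u x ^ 2 * ‖x i - x j‖ ^ (-(2 * s)) else 0 := by
      intro i j
      split_ifs with h
      · exact integrable_sq_mul_norm_rpow hd hs hds hu hcs h.ne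
      · exact integrable_zero _ _ _
    simp only [e1]
    rw [integral_finsetSum _ fun i _ => integrable_finsetSum _ fun j _ => e2 i j]
    refine Finset.sum_congr rfl fun i _ => ?_
    rw [integral_finsetSum _ fun j _ => e2 i j]
    refine Finset.sum_congr rfl fun j _ => ?_
    split_ifs
    · rfl
    · simp
  rw [h_int, kinetic_eq_sum_particleEnergy hd hs hu hcs]
  have h1 := sum_pairs_le_sum hN (e := fun i => a_sd d s * (particleEnergy s u i).toReal) (P := P)
    (C := C_fH d s) (c := c) (fun i j => by simp only [hP, norm_sub_rev])
    (fun i j k hij hik hjk => three_particle_le hd hs hds hu hcs hsupp hij hik hjk)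
  calc _ = ((2 * C_fH d s + c) * ∑ i, ∑ j, if i < j then P i j else 0) / ((N : ℝ) - 1) := by
        field_simp
    _ ≤ _ := by
        rw [div_le_iff₀ hN1, mul_comm _ ((N : ℝ) - 1)]
        exact h1
end
end

section
/- Let d ≥ 1 be an integer, s ∈ (0,1), and let u : ℝ^d → ℝ and ω : ℝ^d → (0,∞) be measurable functions such that u, ω, and u²/ω all have finite Gagliardo seminorm, i.e. ∬_{ℝ^d×ℝ^d} (f(x)−f(y))²/|x−y|^{d+2s} dx dy < ∞ for f ∈ {u, ω, u²/ω}. Then ∬_{ℝ^d×ℝ^d} (u(x)−u(y))²/|x−y|^{d+2s} dx dy ≥ ∬_{ℝ^d×ℝ^d} (ω(x)−ω(y))·((u²/ω)(x)−(u²/ω)(y))/|x−y|^{d+2s} dx dy, the right-hand double integral being absolutely convergent; moreover equality holds if and only if u is almost everywhere a constant multiple of ω. -/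
open MeasureTheory Real

noncomputable section

/-- Picone's identity for differences. -/
theorem picone_identity {a b p q : ℝ} (hp : p ≠ 0) (hq : q ≠ 0) :
    (a - b) ^ 2 - (p - q) * (a ^ 2 / p - b ^ 2 / q) = p * q * (a / p - b / q) ^ 2 := by
  field_simp
  ring

/-- If `f x = f y` for almost every pair `(x, y)`, then `f` is almost everywhere constant. -/
theorem exists_ae_eq_const_of_ae_prod {α β : Type*} [MeasurableSpace α] {μ : Measure α}
    [SFinite μ] [NeZero μ] {f : α → β} (h : ∀ᵐ p ∂μ.prod μ, f p.1 = f p.2) :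
    ∃ c, ∀ᵐ x ∂μ, f x = c := by
  obtain ⟨x, hx⟩ := (Measure.ae_ae_of_ae_prod h).exists
  exact ⟨f x, hx.mono fun y hy => hy.symm⟩

/-- **Lemma 2.2** (ground-state estimate / extraction of potential), expressed via
Gagliardo-type double integrals: `⟨(−Δ)^s u, u⟩ ≥ ⟨(−Δ)^s ω, u²/ω⟩`, with absolute
convergence of the right-hand side and equality iff `u` is a.e. a constant multiple
of `ω`. -/
theorem ground_state_estimate
    (d : ℕ) (hd : 1 ≤ d) (s : ℝ) (hs : s ∈ Set.Ioo (0:ℝ) 1)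
    (u ω : Euc d → ℝ) (hu_meas : Measurable u) (hω_meas : Measurable ω)
    (hω_pos : ∀ x, 0 < ω x)
    (hu_fin : Integrable (fun p : Euc d × Euc d =>
      (u p.1 - u p.2)^2 / ‖p.1 - p.2‖ ^ ((d:ℝ) + 2*s)))
    (hω_fin : Integrable (fun p : Euc d × Euc d =>
      (ω p.1 - ω p.2)^2 / ‖p.1 - p.2‖ ^ ((d:ℝ) + 2*s)))
    (hq_fin : Integrable (fun p : Euc d × Euc d =>
      ((u p.1)^2 / ω p.1 - (u p.2)^2 / ω p.2)^2 / ‖p.1 - p.2‖ ^ ((d:ℝ) + 2*s))) :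
    Integrable (fun p : Euc d × Euc d =>
        (ω p.1 - ω p.2) * ((u p.1)^2 / ω p.1 - (u p.2)^2 / ω p.2)
          / ‖p.1 - p.2‖ ^ ((d:ℝ) + 2*s)) ∧
    (∫ p : Euc d × Euc d,
        (ω p.1 - ω p.2) * ((u p.1)^2 / ω p.1 - (u p.2)^2 / ω p.2)
          / ‖p.1 - p.2‖ ^ ((d:ℝ) + 2*s))
      ≤ ∫ p : Euc d × Euc d, (u p.1 - u p.2)^2 / ‖p.1 - p.2‖ ^ ((d:ℝ) + 2*s) ∧
    ((∫ p : Euc d × Euc d, (u p.1 - u p.2)^2 / ‖p.1 - p.2‖ ^ ((d:ℝ) + 2*s))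
        = (∫ p : Euc d × Euc d,
            (ω p.1 - ω p.2) * ((u p.1)^2 / ω p.1 - (u p.2)^2 / ω p.2)
              / ‖p.1 - p.2‖ ^ ((d:ℝ) + 2*s))
      ↔ ∃ c : ℝ, ∀ᵐ x : Euc d, u x = c * ω x) := by
  let K : Euc d × Euc d → ℝ := fun p => ‖p.1 - p.2‖ ^ ((d:ℝ) + 2*s)
  have hK_nonneg : ∀ p, 0 ≤ K p := fun p => by positivity
  have h_int : Integrable (fun p : Euc d × Euc d =>
      (ω p.1 - ω p.2) * ((u p.1)^2 / ω p.1 - (u p.2)^2 / ω p.2) / K p) := by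
    refine (hω_fin.add hq_fin).mono' (Measurable.aestronglyMeasurable (by fun_prop))
      (Filter.Eventually.of_forall fun p => ?_)
    rw [Pi.add_apply, ← add_div, norm_eq_abs, abs_div, abs_of_nonneg (hK_nonneg p)]
    refine div_le_div_of_nonneg_right (abs_le.2 ⟨?_, ?_⟩) (hK_nonneg p)
    · nlinarith [sq_nonneg ((ω p.1 - ω p.2) + ((u p.1)^2 / ω p.1 - (u p.2)^2 / ω p.2)),
        sq_nonneg (ω p.1 - ω p.2), sq_nonneg ((u p.1)^2 / ω p.1 - (u p.2)^2 / ω p.2)]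
    · nlinarith [sq_nonneg ((ω p.1 - ω p.2) - ((u p.1)^2 / ω p.1 - (u p.2)^2 / ω p.2)),
        sq_nonneg (ω p.1 - ω p.2), sq_nonneg ((u p.1)^2 / ω p.1 - (u p.2)^2 / ω p.2)]
  have h_diff : ∀ p : Euc d × Euc d, (u p.1 - u p.2)^2 / K p
      - (ω p.1 - ω p.2) * ((u p.1)^2 / ω p.1 - (u p.2)^2 / ω p.2) / K p
      = ω p.1 * ω p.2 * (u p.1 / ω p.1 - u p.2 / ω p.2) ^ 2 / K p := fun p => by
    rw [← sub_div, picone_identity (hω_pos p.1).ne' (hω_pos p.2).ne']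
  have h_nonneg : ∀ p : Euc d × Euc d,
      0 ≤ ω p.1 * ω p.2 * (u p.1 / ω p.1 - u p.2 / ω p.2) ^ 2 / K p := fun p =>
    div_nonneg (mul_nonneg (mul_pos (hω_pos _) (hω_pos _)).le (sq_nonneg _)) (hK_nonneg p)
  have h_diff_int : Integrable (fun p : Euc d × Euc d =>
      ω p.1 * ω p.2 * (u p.1 / ω p.1 - u p.2 / ω p.2) ^ 2 / K p) :=
    (hu_fin.sub h_int).congr (Filter.Eventually.of_forall h_diff)
  have h_sub := (integral_congr_ae (Filter.Eventually.of_forall h_diff)).symm.trans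
    (integral_sub hu_fin h_int)
  have h_zero : ∀ p : Euc d × Euc d,
      ω p.1 * ω p.2 * (u p.1 / ω p.1 - u p.2 / ω p.2) ^ 2 / K p = 0 ↔
        u p.1 / ω p.1 = u p.2 / ω p.2 := fun p => by
    rcases eq_or_ne p.1 p.2 with h | h
    · simp [h]
    · have hKp : K p ≠ 0 := (rpow_pos_of_pos (norm_pos_iff.2 (sub_ne_zero.2 h)) _).ne'
      simp [hKp, (hω_pos _).ne', sub_eq_zero]
  refine ⟨h_int, ?_, ?_⟩
  · rw [← sub_nonneg, ← h_sub]
    exact integral_nonneg h_nonneg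
  · rw [← sub_eq_zero, ← h_sub, integral_eq_zero_iff_of_nonneg h_nonneg h_diff_int]
    simp only [Filter.EventuallyEq, Pi.zero_apply, h_zero, ← div_eq_iff (hω_pos _).ne']
    constructor
    · exact exists_ae_eq_const_of_ae_prod (f := fun x => u x / ω x)
    · rintro ⟨c, hc⟩
      filter_upwards [Measure.quasiMeasurePreserving_fst.ae hc,
        Measure.quasiMeasurePreserving_snd.ae hc] with p h₁ h₂
      rw [h₁, h₂]
end
end

section
/- Let d ≥ 2 be an integer and let d₁, d₃ be real exponents with 0 < d₁ < d, 0 < d₃ < d, and d₁ + d₃ > d. Let e₁ be the first standard basis vector of ℝ^d and let φ be a complex-valued Schwartz function on ℝ^d with Fourier transform φ̂(ξ) := ∫_{ℝ^d} e^{−2πi ξ·x} φ(x) dx. Then both of the following integrals converge absolutely and ∫_{ℝ^d} (w₁/(|w|^{d−d₃+1}·|w−e₁|^{d−d₁})) · φ̂(w) dw = (c_{d₁}·c_{d₃+1})/(i·c_{d−d₁}·c_{d−d₃+1}) · ∫_{ℝ^d} ( ∫_{ℝ^d} ((ξ−y)·e₁/|ξ−y|^{d₃+1}) · (e^{−2πi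 y·e₁}/|y|^{d₁}) dy ) · φ(ξ) dξ, where w₁ denotes the first coordinate of w. -/
open MeasureTheory Real
open scoped RealInnerProductSpace

noncomputable section

/-- The Lieb–Loss constant `c_μ = π^{−μ/2} Γ(μ/2)`. -/
def cLL (μ : ℝ) : ℝ := Real.pi ^ (-μ/2) * Real.Gamma (μ/2)

lemma cLL_pos {μ : ℝ} (hμ : 0 < μ) : 0 < cLL μ :=
  mul_pos (rpow_pos_of_pos pi_pos _) (Gamma_pos_of_pos (by linarith))

section GaussianSuperposition

variable {a r : ℝ}

lemma integrableOn_rpow_mul_exp_neg_pi_mul (ha : 0 < a) (hr : 0 < r) :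
    IntegrableOn (fun s : ℝ => s ^ (a / 2 - 1) * exp (-(π * s * r ^ 2))) (Set.Ioi 0) := by
  have h := integrableOn_rpow_mul_exp_neg_mul_rpow (s := a / 2 - 1) (p := 1) (b := π * r ^ 2)
    (by linarith) one_pos (by positivity)
  refine h.congr_fun (fun s _ => ?_) measurableSet_Ioi
  simp only [rpow_one]
  ring_nf

lemma integral_rpow_mul_exp_neg_pi_mul (ha : 0 < a) (hr : 0 < r) :
    ∫ s in Set.Ioi (0 : ℝ), s ^ (a / 2 - 1) * exp (-(π * s * r ^ 2)) = cLL a * r ^ (-a) := by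
  have h := integral_rpow_mul_exp_neg_mul_Ioi (a := a / 2) (r := π * r ^ 2)
    (by linarith) (by positivity)
  have e : ∀ s : ℝ, π * s * r ^ 2 = π * r ^ 2 * s := fun s => by ring
  simp_rw [e, h, cLL]
  rw [one_div, inv_rpow (by positivity), mul_rpow pi_pos.le (by positivity), mul_inv,
    ← rpow_natCast, ← rpow_mul hr.le, rpow_neg hr.le, neg_div, rpow_neg pi_pos.le]
  rw [show ((2 : ℕ) : ℝ) * (a / 2) = a by push_cast; ring]
  ring

lemma rpow_neg_two_smul_comp_inv {s : ℝ} (hs : 0 < s) :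
    s ^ ((-1 : ℝ) - 1) * ((s ^ (-1 : ℝ)) ^ (a / 2 - 1) * exp (-(π * s ^ (-1 : ℝ) * r ^ 2))) =
      s ^ (-(a / 2) - 1) * exp (-(π * r ^ 2 / s)) := by
  rw [← mul_assoc, ← rpow_mul hs.le, ← rpow_add hs, rpow_neg_one]
  congr 2 <;> ring

lemma integrableOn_rpow_mul_exp_neg_pi_div (ha : 0 < a) (hr : 0 < r) :
    IntegrableOn (fun s : ℝ => s ^ (-(a / 2) - 1) * exp (-(π * r ^ 2 / s))) (Set.Ioi 0) := by
  have h := (integrableOn_Ioi_comp_rpow_iff' _ (by norm_num : (-1 : ℝ) ≠ 0)).2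
    (integrableOn_rpow_mul_exp_neg_pi_mul ha hr)
  exact h.congr_fun (fun s hs => rpow_neg_two_smul_comp_inv hs) measurableSet_Ioi

lemma integral_rpow_mul_exp_neg_pi_div (ha : 0 < a) (hr : 0 < r) :
    ∫ s in Set.Ioi (0 : ℝ), s ^ (-(a / 2) - 1) * exp (-(π * r ^ 2 / s)) = cLL a * r ^ (-a) := by
  rw [← integral_rpow_mul_exp_neg_pi_mul ha hr,
    ← integral_comp_rpow_Ioi (fun s => s ^ (a / 2 - 1) * exp (-(π * s * r ^ 2)))
      (by norm_num : (-1 : ℝ) ≠ 0)]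
  refine setIntegral_congr_fun measurableSet_Ioi (fun s hs => ?_)
  simp only [abs_neg, abs_one, one_mul, smul_eq_mul]
  exact (rpow_neg_two_smul_comp_inv hs).symm

end GaussianSuperposition

/-- Fubini for a kernel `K` that is a superposition of nonnegative kernels `κ (·, t)`. -/
lemma integral_ofReal_mul_eq_integral_integral {X T : Type*} [MeasurableSpace X]
    [MeasurableSpace T] {μ : Measure X} {ν : Measure T} [SFinite μ] [SFinite ν]
    {κ : X × T → ℝ} {K : X → ℝ} {g : X → ℂ} (hκ : Measurable κ)
    (hκ0 : ∀ x, ∀ᵐ t ∂ν, 0 ≤ κ (x, t))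
    (hκint : ∀ᵐ x ∂μ, Integrable (fun t => κ (x, t)) ν)
    (hK : ∀ᵐ x ∂μ, ∫ t, κ (x, t) ∂ν = K x)
    (hg : AEStronglyMeasurable g μ) (hKg : Integrable (fun x => (K x : ℂ) * g x) μ) :
    ∫ x, (K x : ℂ) * g x ∂μ = ∫ t, ∫ x, (κ (x, t) : ℂ) * g x ∂μ ∂ν := by
  have hint : Integrable (fun p : X × T => (κ p : ℂ) * g p.1) (μ.prod ν) := by
    rw [integrable_prod_iff]
    · refine ⟨?_, hKg.norm.congr ?_⟩
      · filter_upwards [hκint] with x hx using hx.ofReal.mul_const _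
      · filter_upwards [hK] with x hx
        simp only [norm_mul, Complex.norm_real]
        rw [integral_mul_const, ← hx, Real.norm_of_nonneg (integral_nonneg_of_ae (hκ0 x))]
        congr 1
        refine integral_congr_ae ?_
        filter_upwards [hκ0 x] with t ht using (Real.norm_of_nonneg ht).symm
    · exact (Complex.measurable_ofReal.comp hκ).aestronglyMeasurable.mul hg.comp_fst
  rw [← integral_integral_swap hint]
  refine integral_congr_ae ?_
  filter_upwards [hK] with x hx
  rw [integral_mul_const, integral_complex_ofReal, hx]

section LocalPower

variable {V : Type*} [NormedAddCommGroup V]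

/-- The singular part `‖x‖ ^ (-γ)` on the unit ball of a power weight. -/
def localPower (γ : ℝ) (x : V) : ℝ := (Metric.ball (0 : V) 1).indicator (fun x => ‖x‖ ^ (-γ)) x

lemma localPower_nonneg (γ : ℝ) (x : V) : 0 ≤ localPower γ x :=
  Set.indicator_nonneg (fun _ _ => by positivity) x

lemma measurable_localPower [MeasurableSpace V] [OpensMeasurableSpace V] (γ : ℝ) :
    Measurable (localPower (V := V) γ) :=
  (measurable_norm.pow_const _).indicator measurableSet_ball

lemma localPower_of_lt {γ : ℝ} {x : V} (hx : ‖x‖ < 1) : localPower γ x = ‖x‖ ^ (-γ) :=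
  Set.indicator_of_mem (by simpa using hx) _

lemma rpow_neg_le_localPower_add_one {γ : ℝ} (hγ : 0 ≤ γ) (x : V) :
    ‖x‖ ^ (-γ) ≤ localPower γ x + 1 := by
  rcases lt_or_ge ‖x‖ 1 with h | h
  · rw [localPower_of_lt h]
    linarith
  · have := rpow_le_one_of_one_le_of_nonpos h (neg_nonpos.2 hγ)
    linarith [localPower_nonneg γ x]

lemma rpow_neg_le_two_rpow_mul {γ : ℝ} (hγ : 0 ≤ γ) {x : V} (hx : 1 ≤ ‖x‖) :
    ‖x‖ ^ (-γ) ≤ 2 ^ γ * (1 + ‖x‖) ^ (-γ) := by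
  have h : (2 * ‖x‖) ^ (-γ) ≤ (1 + ‖x‖) ^ (-γ) :=
    rpow_le_rpow_of_nonpos (by positivity) (by linarith) (by linarith)
  rw [mul_rpow zero_le_two (norm_nonneg x), rpow_neg zero_le_two] at h
  rwa [← inv_mul_le_iff₀ (by positivity)]

lemma rpow_neg_mul_rpow_neg_le {a b r q : ℝ} (ha : 0 < a) (hb : 0 < b) (hr : 0 ≤ r)
    (hq : 0 ≤ q) : r ^ (-a) * q ^ (-b) ≤ r ^ (-(a + b)) + q ^ (-(a + b)) := by
  rcases hr.eq_or_lt with rfl | hr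
  · rw [zero_rpow (by linarith), zero_mul]
    positivity
  rcases hq.eq_or_lt with rfl | hq
  · rw [zero_rpow (x := -b) (by linarith), mul_zero]
    positivity
  rw [neg_add, rpow_add hr, rpow_add hq]
  rcases le_total r q with h | h
  · have := rpow_le_rpow_of_nonpos hr h (neg_nonpos.2 hb.le)
    calc r ^ (-a) * q ^ (-b) ≤ r ^ (-a) * r ^ (-b) := by gcongr
      _ ≤ _ := le_add_of_nonneg_right (by positivity)
  · have := rpow_le_rpow_of_nonpos hq h (neg_nonpos.2 ha.le)
    calc r ^ (-a) * q ^ (-b) ≤ q ^ (-a) * q ^ (-b) := by gcongr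
      _ ≤ _ := le_add_of_nonneg_left (by positivity)

lemma rpow_neg_mul_rpow_neg_le_localPower {a b : ℝ} (ha : 0 < a) (hb : 0 < b) (u v : V) :
    ‖u‖ ^ (-a) * ‖v‖ ^ (-b) ≤ localPower a u * localPower b v + localPower a u + localPower b v
      + 2 ^ (a + b) * (1 + ‖u‖) ^ (-(a + b)) + 2 ^ (a + b) * (1 + ‖v‖) ^ (-(a + b)) := by
  have hu := localPower_nonneg a u
  have hv := localPower_nonneg b v
  have hU : 0 ≤ (2 : ℝ) ^ (a + b) * (1 + ‖u‖) ^ (-(a + b)) := by positivity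
  have hV : 0 ≤ (2 : ℝ) ^ (a + b) * (1 + ‖v‖) ^ (-(a + b)) := by positivity
  have huv := mul_nonneg hu hv
  rcases lt_or_ge ‖u‖ 1 with h | h <;> rcases lt_or_ge ‖v‖ 1 with h' | h'
  · rw [← localPower_of_lt h, ← localPower_of_lt h']
    linarith
  · rw [← localPower_of_lt h]
    have := mul_le_of_le_one_right hu (rpow_le_one_of_one_le_of_nonpos h' (neg_nonpos.2 hb.le))
    linarith
  · rw [← localPower_of_lt h']
    have := mul_le_of_le_one_left hv (rpow_le_one_of_one_le_of_nonpos h (neg_nonpos.2 ha.le))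
    linarith
  · have h1 := rpow_neg_mul_rpow_neg_le ha hb (norm_nonneg u) (norm_nonneg v)
    have h2 := rpow_neg_le_two_rpow_mul (γ := a + b) (by linarith) h
    have h3 := rpow_neg_le_two_rpow_mul (γ := a + b) (by linarith) h'
    linarith

end LocalPower

section Fourier

variable {V : Type*} [NormedAddCommGroup V] [InnerProductSpace ℝ V]

/-- The character `e^{-2πi ⟪w, x⟫}`. -/
def phase (w x : V) : ℂ := Complex.exp ((↑(-(2 * π * ⟪w, x⟫)) : ℂ) * Complex.I)

lemma norm_phase (w x : V) : ‖phase w x‖ = 1 := Complex.norm_exp_ofReal_mul_I _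

lemma continuous_phase : Continuous (fun p : V × V => phase p.1 p.2) := by
  unfold phase; fun_prop

lemma phase_mul_phase_neg (w y e : V) : phase w (-y) * phase y e = phase y (e - w) := by
  unfold phase
  rw [← Complex.exp_add, inner_sub_right, inner_neg_right, real_inner_comm w y]
  congr 1
  push_cast
  ring

lemma phase_sub (w x y : V) : phase w (x - y) = phase w x * phase w (-y) := by
  unfold phase
  rw [← Complex.exp_add, inner_sub_right, inner_neg_right]
  congr 1
  push_cast
  ring

lemma abs_inner_div_rpow_le {e : V} (he : ‖e‖ = 1) (c : ℝ) (u : V) :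
    |⟪u, e⟫ / ‖u‖ ^ (c + 1)| ≤ ‖u‖ ^ (-c) := by
  rcases (norm_nonneg u).eq_or_lt with h | h
  · rw [norm_eq_zero.1 h.symm]
    simp only [inner_zero_left, zero_div, abs_zero]
    positivity
  · have h1 : |⟪u, e⟫| ≤ ‖u‖ := by simpa [he] using abs_real_inner_le_norm u e
    rw [abs_div, abs_of_nonneg (by positivity : 0 ≤ ‖u‖ ^ (c + 1)), div_le_iff₀ (by positivity),
      ← rpow_add h]
    simpa using h1

variable [FiniteDimensional ℝ V] [MeasurableSpace V] [BorelSpace V]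

lemma integrable_phase_mul {f : V → ℂ} (hf : Integrable f) (ξ : V) :
    Integrable (fun x => phase x ξ * f x) :=
  hf.bdd_mul (c := 1) (by unfold phase; fun_prop)
    (ae_of_all _ fun x => (norm_phase x ξ).le)

lemma integral_mul_integral_phase_mul_integral_phase {G h φ : V → ℂ} (hG : Integrable G)
    (hh : Integrable h) (hφ : Integrable φ) :
    ∫ w, G w * ((∫ x, phase w x * φ x) * ∫ y, phase w (-y) * h y) =
      ∫ p : V × V, (∫ w, phase w (p.1 - p.2) * G w) * (φ p.1 * h p.2) := by
  have hint : Integrable (fun q : V × (V × V) =>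
      phase q.1 (q.2.1 - q.2.2) * (G q.1 * (φ q.2.1 * h q.2.2)))
      (volume.prod (volume.prod volume)) := by
    refine (hG.mul_prod (hφ.mul_prod hh)).bdd_mul (c := 1) ?_
      (ae_of_all _ fun q => (norm_phase _ _).le)
    unfold phase
    fun_prop
  calc
    _ = ∫ w, ∫ p : V × V, phase w (p.1 - p.2) * (G w * (φ p.1 * h p.2)) := by
      congr 1 with w
      rw [← integral_prod_mul, ← integral_const_mul]
      refine integral_congr_ae (ae_of_all _ fun p => ?_)
      simp only [phase_sub]
      ring
    _ = ∫ p : V × V, ∫ w, phase w (p.1 - p.2) * (G w * (φ p.1 * h p.2)) :=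
      integral_integral_swap hint
    _ = _ := by
      congr 1 with p
      rw [← integral_mul_const]
      simp only [mul_assoc]

open Module (finrank)

lemma integral_phase_mul_gaussian {s : ℝ} (hs : 0 < s) (ξ : V) :
    ∫ w : V, phase w ξ * (exp (-(π * s * ‖w‖ ^ 2)) : ℂ) =
      (s ^ (-(finrank ℝ V / 2 : ℝ)) * exp (-(π * ‖ξ‖ ^ 2 / s)) : ℝ) := by
  have h := GaussianFourier.integral_cexp_neg_mul_sq_norm_add (b := (π * s : ℝ)) (V := V)
    (by rw [Complex.ofReal_re]; positivity) (-(2 * π * Complex.I)) ξ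
  have hs' : (s : ℂ) ≠ 0 := by exact_mod_cast hs.ne'
  have hπ : (π : ℂ) ≠ 0 := by exact_mod_cast pi_ne_zero
  calc
    _ = ∫ w : V, Complex.exp (-((π * s : ℝ) : ℂ) * ‖w‖ ^ 2
          + -(2 * π * Complex.I) * ⟪ξ, w⟫) := by
      congr 1 with w
      unfold phase
      rw [Complex.ofReal_exp, ← Complex.exp_add, real_inner_comm]
      congr 1
      push_cast
      ring
    _ = _ := by
      rw [h, Complex.ofReal_mul (s ^ _), Complex.ofReal_exp]
      congr 1
      · rw [← Complex.ofReal_div, div_mul_eq_div_div, div_self pi_ne_zero, one_div,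
          rpow_neg hs.le, ← inv_rpow hs.le, Complex.ofReal_cpow (by positivity)]
        push_cast
        rfl
      · congr 1
        push_cast
        field_simp
        rw [Complex.I_sq]
        ring

lemma integrable_gaussian {s : ℝ} (hs : 0 < s) :
    Integrable (fun w : V => (exp (-(π * s * ‖w‖ ^ 2)) : ℂ)) := by
  have h := GaussianFourier.integrable_cexp_neg_mul_sq_norm_add (b := (π * s : ℝ)) (V := V)
    (by rw [Complex.ofReal_re]; positivity) 0 0
  refine h.congr (ae_of_all _ fun w => ?_)
  simp only [Complex.ofReal_exp]
  congr 1
  push_cast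
  ring

lemma integrable_norm_mul_gaussian [Nontrivial V] {s : ℝ} (hs : 0 < s) :
    Integrable (fun w : V => ‖w‖ * exp (-(π * s * ‖w‖ ^ 2))) := by
  rw [integrable_fun_norm_addHaar volume (f := fun r => r * exp (-(π * s * r ^ 2)))]
  have h := integrableOn_rpow_mul_exp_neg_mul_sq (b := π * s) (by positivity)
    (s := (finrank ℝ V : ℝ)) (by have : (0 : ℝ) ≤ finrank ℝ V := by positivity
                                 linarith)
  refine h.congr_fun (fun r _ => ?_) measurableSet_Ioi
  have hn : finrank ℝ V - 1 + 1 = finrank ℝ V :=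
    Nat.sub_add_cancel (Module.finrank_pos (R := ℝ) (M := V))
  simp only [smul_eq_mul, rpow_natCast]
  rw [← mul_assoc, ← pow_succ, hn]
  ring_nf

lemma integrable_inner_mul_gaussian [Nontrivial V] {s : ℝ} (hs : 0 < s) (e : V) :
    Integrable (fun w : V => ((⟪w, e⟫ * exp (-(π * s * ‖w‖ ^ 2)) : ℝ) : ℂ)) := by
  refine ((integrable_norm_mul_gaussian (V := V) hs).const_mul ‖e‖).mono' (by fun_prop)
    (ae_of_all _ fun w => ?_)
  rw [Complex.norm_real, norm_mul, Real.norm_of_nonneg (exp_pos _).le, ← mul_assoc,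
    mul_comm ‖e‖]
  gcongr
  exact norm_inner_le_norm w e

lemma integral_phase_mul_inner_mul_gaussian [Nontrivial V] {s : ℝ} (hs : 0 < s) (e ξ : V) :
    ∫ w : V, phase w ξ * ((⟪w, e⟫ * exp (-(π * s * ‖w‖ ^ 2)) : ℝ) : ℂ) =
      -Complex.I * (⟪ξ, e⟫ * (s ^ (-(finrank ℝ V / 2 : ℝ) - 1) * exp (-(π * ‖ξ‖ ^ 2 / s))) : ℝ) := by
  let g : V → ℂ := fun w => (exp (-(π * s * ‖w‖ ^ 2)) : ℂ)
  have hf : ∀ x : V, HasLineDerivAt ℝ (fun w => phase w ξ)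
      (-(2 * π * ⟪e, ξ⟫ : ℝ) * Complex.I * phase x ξ) x e := by
    intro x
    unfold HasLineDerivAt phase
    have h1 : HasDerivAt (fun t : ℝ => -(2 * π * ⟪x + t • e, ξ⟫)) (-(2 * π * ⟪e, ξ⟫)) 0 := by
      simp only [inner_add_left, inner_smul_left, conj_trivial]
      simpa using ((((hasDerivAt_id (0 : ℝ)).mul_const ⟪e, ξ⟫).const_add ⟪x, ξ⟫).const_mul
        (2 * π)).fun_neg
    have h2 := ((h1.ofReal_comp.mul_const Complex.I).cexp)
    refine h2.congr_deriv ?_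
    simp
    ring
  have hg : ∀ x : V, HasLineDerivAt ℝ g
      (-(2 * π * s) * ((⟪x, e⟫ * exp (-(π * s * ‖x‖ ^ 2)) : ℝ) : ℂ)) x e := by
    intro x
    unfold HasLineDerivAt
    have h1 : HasDerivAt (fun t : ℝ => -(π * s * ‖x + t • e‖ ^ 2)) (-(π * s * (2 * ⟪x, e⟫))) 0 := by
      have h0 : HasDerivAt (fun t : ℝ => x + t • e) e 0 := by
        simpa using ((hasDerivAt_id (0 : ℝ)).smul_const e).const_add x
      simpa using (h0.norm_sq.const_mul (π * s)).fun_neg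
    have h2 := h1.exp.ofReal_comp
    refine h2.congr_deriv ?_
    simp
    ring
  have hG := integrable_inner_mul_gaussian (V := V) hs e
  have hg0 := integrable_gaussian (V := V) hs
  have ibp := integral_bilinear_hasLineDerivAt_right_eq_neg_left_of_integrable (μ := volume)
    (B := ContinuousLinearMap.mul ℝ ℂ) (f := fun w => phase w ξ) (g := g) (v := e)
    (f' := fun x => -(2 * π * ⟪e, ξ⟫ : ℝ) * Complex.I * phase x ξ)
    (g' := fun x => -(2 * π * s) * ((⟪x, e⟫ * exp (-(π * s * ‖x‖ ^ 2)) : ℝ) : ℂ))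
    ?_ ?_ ?_ (fun x _ => hf x) (fun x _ => hg x)
  · simp only [ContinuousLinearMap.mul_apply'] at ibp
    have e1 : ∀ x : V, phase x ξ * (-(2 * π * s) *
        ((⟪x, e⟫ * exp (-(π * s * ‖x‖ ^ 2)) : ℝ) : ℂ)) = -(2 * π * s) * (phase x ξ *
        ((⟪x, e⟫ * exp (-(π * s * ‖x‖ ^ 2)) : ℝ) : ℂ)) := fun x => by ring
    simp only [e1, mul_assoc (_ * Complex.I)] at ibp
    rw [integral_const_mul, integral_const_mul] at ibp
    simp only [g] at ibp
    rw [integral_phase_mul_gaussian hs] at ibp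
    have hs' : (s : ℂ) ≠ 0 := by exact_mod_cast hs.ne'
    have hπ : (π : ℂ) ≠ 0 := by exact_mod_cast pi_ne_zero
    have h2 : (-(2 * π * s) : ℂ) ≠ 0 := by simp [hs', hπ]
    apply mul_left_cancel₀ h2
    rw [ibp, rpow_sub_one hs.ne', real_inner_comm]
    push_cast
    field_simp
  · simp only [ContinuousLinearMap.mul_apply', mul_assoc, g]
    simpa only [mul_assoc] using ((integrable_phase_mul hg0 ξ).const_mul
      (-(2 * π * ⟪e, ξ⟫ : ℝ) * Complex.I))
  · exact integrable_phase_mul (hG.const_mul _) ξ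
  · exact integrable_phase_mul hg0 ξ

lemma integrable_phase_mul_gaussian {t : ℝ} (ht : 0 < t) (e : V) :
    Integrable (fun y : V =>
      phase y e * ((t ^ (-(finrank ℝ V / 2 : ℝ)) * exp (-(π * ‖y‖ ^ 2 / t)) : ℝ) : ℂ)) := by
  refine integrable_phase_mul ?_ e
  refine ((integrable_gaussian (V := V) (inv_pos.2 ht)).const_mul
    ((t ^ (-(finrank ℝ V / 2 : ℝ)) : ℝ) : ℂ)).congr (ae_of_all _ fun y => ?_)
  simp only [← Complex.ofReal_mul]
  congr 3
  ring_nf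

lemma integral_phase_neg_mul_phase_mul_gaussian {t : ℝ} (ht : 0 < t) (e w : V) :
    ∫ y : V, phase w (-y) *
      (phase y e * ((t ^ (-(finrank ℝ V / 2 : ℝ)) * exp (-(π * ‖y‖ ^ 2 / t)) : ℝ) : ℂ)) =
      (exp (-(π * t * ‖w - e‖ ^ 2)) : ℝ) := by
  have h := integral_phase_mul_gaussian (inv_pos.2 ht) (e - w)
  have e1 : ∀ y : V, phase w (-y) *
      (phase y e * ((t ^ (-(finrank ℝ V / 2 : ℝ)) * exp (-(π * ‖y‖ ^ 2 / t)) : ℝ) : ℂ)) =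
      ((t ^ (-(finrank ℝ V / 2 : ℝ)) : ℝ) : ℂ) *
        (phase y (e - w) * (exp (-(π * t⁻¹ * ‖y‖ ^ 2)) : ℂ)) := by
    intro y
    rw [← mul_assoc, phase_mul_phase_neg, Complex.ofReal_mul,
      show π * ‖y‖ ^ 2 / t = π * t⁻¹ * ‖y‖ ^ 2 by ring]
    ring
  simp only [e1]
  rw [integral_const_mul, h, ← Complex.ofReal_mul, ← mul_assoc, ← mul_rpow ht.le (by positivity),
    mul_inv_cancel₀ ht.ne', one_rpow, one_mul, norm_sub_rev]
  congr 3
  field_simp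

lemma integral_gaussian_mul_gaussian_mul_fourier [Nontrivial V] {s t : ℝ} (hs : 0 < s)
    (ht : 0 < t) (e : V) {φ : V → ℂ} (hφ : Integrable φ) :
    ∫ w : V, (exp (-(π * s * ‖w‖ ^ 2)) * exp (-(π * t * ‖w - e‖ ^ 2)) : ℝ) *
        (⟪w, e⟫ * ∫ x, phase w x * φ x) =
      ∫ p : V × V, (s ^ (-(finrank ℝ V / 2 : ℝ) - 1) * exp (-(π * ‖p.1 - p.2‖ ^ 2 / s)) *
        (t ^ (-(finrank ℝ V / 2 : ℝ)) * exp (-(π * ‖p.2‖ ^ 2 / t))) : ℝ) *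
        (-Complex.I * ⟪p.1 - p.2, e⟫ * (phase p.2 e * φ p.1)) := by
  have h := integral_mul_integral_phase_mul_integral_phase
    (integrable_inner_mul_gaussian (V := V) hs e) (integrable_phase_mul_gaussian ht e) hφ
  simp only [integral_phase_neg_mul_phase_mul_gaussian ht,
    integral_phase_mul_inner_mul_gaussian hs] at h
  convert h using 1
  · congr 1 with w
    push_cast
    ring
  · congr 1 with p
    push_cast
    ring

lemma integrable_localPower [Nontrivial V] {γ : ℝ} (hγ : γ < finrank ℝ V) :
    Integrable (localPower (V := V) γ) := by
  unfold localPower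
  rw [integrable_indicator_iff measurableSet_ball]
  refine integrableOn_ball_of_norm_le_rpow (Module.finrank_pos (R := ℝ)) (C := 1) hγ
    (ae_of_all _ fun x => ?_) (measurable_norm.pow_const _).aestronglyMeasurable
  rw [Real.norm_of_nonneg (by positivity), one_mul]

lemma integrable_rpow_norm_sub_mul [Nontrivial V] {γ C : ℝ} (hγ0 : 0 ≤ γ)
    (hγ : γ < finrank ℝ V) (e : V) {ψ : V → ℝ} (hψ : Integrable ψ) (hC : ∀ x, ‖ψ x‖ ≤ C) :
    Integrable (fun w => ‖w - e‖ ^ (-γ) * ψ w) := by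
  have h1 : Integrable (fun w => ψ w * localPower γ (w - e)) :=
    ((integrable_localPower hγ).comp_sub_right e).bdd_mul hψ.1 (ae_of_all _ hC)
  refine (h1.norm.add hψ.norm).mono' (((measurable_norm.comp (measurable_id.sub_const e)).pow_const
    _).aestronglyMeasurable.mul hψ.1) (ae_of_all _ fun w => ?_)
  rw [Pi.add_apply, norm_mul, norm_mul, Real.norm_of_nonneg (by positivity),
    Real.norm_of_nonneg (localPower_nonneg _ _)]
  nlinarith [rpow_neg_le_localPower_add_one hγ0 (w - e), norm_nonneg (ψ w)]

lemma integrable_inner_div_mul [Nontrivial V] {e : V} (he : ‖e‖ = 1) {a b C : ℝ} (ha : 0 < a)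
    (hb : 0 < b) (hab : a + b < finrank ℝ V) {ψ : V → ℂ} (hψ : Integrable ψ)
    (hC : ∀ x, ‖ψ x‖ ≤ C) :
    Integrable (fun w => ((⟪w, e⟫ / (‖w‖ ^ (a + 1) * ‖w - e‖ ^ b) : ℝ) : ℂ) * ψ w) := by
  have hC' : ∀ x, ‖‖ψ x‖‖ ≤ C := by simpa using hC
  have h0 := integrable_rpow_norm_sub_mul (by linarith) hab 0 hψ.norm hC'
  have h1 := integrable_rpow_norm_sub_mul (by linarith) hab e hψ.norm hC'
  refine (h0.add h1).mono' ?_ (ae_of_all _ fun w => ?_)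
  · refine AEStronglyMeasurable.mul (Measurable.aestronglyMeasurable ?_) hψ.1
    fun_prop
  · rw [Pi.add_apply, sub_zero, norm_mul, Complex.norm_real, ← add_mul, Real.norm_eq_abs,
      ← div_div, abs_div, abs_of_nonneg (by positivity : 0 ≤ ‖w - e‖ ^ b), div_eq_mul_inv,
      ← rpow_neg (norm_nonneg _)]
    gcongr
    refine le_trans ?_ (rpow_neg_mul_rpow_neg_le ha hb (norm_nonneg w) (norm_nonneg (w - e)))
    gcongr
    exact abs_inner_div_rpow_le he a w

lemma integrable_mul_rpow_mul_rpow [Nontrivial V] {a b C : ℝ} (ha : 0 < a) (hb : 0 < b)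
    (han : a < finrank ℝ V) (hbn : b < finrank ℝ V) (hab : finrank ℝ V < a + b) {φ : V → ℂ}
    (hφ : Integrable φ) (hC : ∀ x, ‖φ x‖ ≤ C) :
    Integrable (fun p : V × V => ‖φ p.1‖ * (‖p.1 - p.2‖ ^ (-a) * ‖p.2‖ ^ (-b)))
      (volume.prod volume) := by
  have hconv {f : V → ℝ} (hf : Integrable f) :
      Integrable (fun p : V × V => ‖φ p.1‖ * f (p.1 - p.2)) (volume.prod volume) := by
    simpa [Function.comp_def] using
      (measurePreserving_prod_sub volume volume).integrable_comp_of_integrable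
        (hφ.norm.mul_prod hf.comp_neg)
  have ha' := integrable_localPower (V := V) han
  have hb' := integrable_localPower (V := V) hbn
  have hJ : Integrable (fun x : V => 2 ^ (a + b) * (1 + ‖x‖) ^ (-(a + b))) :=
    (integrable_one_add_norm hab).const_mul _
  have hloc : Integrable
      (fun p : V × V => ‖φ p.1‖ * (localPower a (p.1 - p.2) * localPower b p.2))
      (volume.prod volume) :=
    ((measurePreserving_sub_prod volume volume).integrable_comp_of_integrable
      (ha'.mul_prod hb')).bdd_mul hφ.1.norm.comp_fst (c := C)
      (ae_of_all _ fun p => by simpa using hC p.1)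
  refine ((((hloc.add (hconv ha')).add (hφ.norm.mul_prod hb')).add (hconv hJ)).add
    (hφ.norm.mul_prod hJ)).mono' ?_ (ae_of_all _ fun p => ?_)
  · refine hφ.1.norm.comp_fst.mul (Measurable.aestronglyMeasurable ?_)
    fun_prop
  · simp only [Pi.add_apply]
    rw [Real.norm_of_nonneg (by positivity), ← mul_add, ← mul_add, ← mul_add, ← mul_add]
    gcongr
    exact rpow_neg_mul_rpow_neg_le_localPower ha hb _ _

lemma integrable_riesz_kernel_mul [Nontrivial V] {e : V} (he : ‖e‖ = 1) {d₁ d₃ C : ℝ}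
    (h₁ : d₁ ∈ Set.Ioo 0 (finrank ℝ V : ℝ)) (h₃ : d₃ ∈ Set.Ioo 0 (finrank ℝ V : ℝ))
    (h₁₃ : finrank ℝ V < d₁ + d₃) {φ : V → ℂ} (hφ : Integrable φ) (hC : ∀ x, ‖φ x‖ ≤ C) :
    Integrable (fun p : V × V => ((⟪p.1 - p.2, e⟫ / ‖p.1 - p.2‖ ^ (d₃ + 1) : ℝ) : ℂ) *
      (phase p.2 e / (‖p.2‖ ^ d₁ : ℝ)) * φ p.1) (volume.prod volume) := by
  refine (integrable_mul_rpow_mul_rpow h₃.1 h₁.1 h₃.2 h₁.2 (by linarith) hφ hC).mono' ?_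
    (ae_of_all _ fun p => ?_)
  · refine AEStronglyMeasurable.mul (Measurable.aestronglyMeasurable ?_) hφ.1.comp_fst
    unfold phase
    fun_prop
  · rw [norm_mul, norm_mul, norm_div, norm_phase, Complex.norm_real, Complex.norm_real,
      Real.norm_eq_abs, Real.norm_of_nonneg (by positivity : 0 ≤ ‖p.2‖ ^ d₁), one_div,
      ← rpow_neg (norm_nonneg _), mul_comm]
    gcongr
    exact abs_inner_div_rpow_le he d₃ _

lemma integral_ofReal_mul_eq_integral_integral_of_mul {X : Type*} [MeasurableSpace X]
    {μ : Measure X} [SFinite μ] {p q : ℝ → ℝ → ℝ} {P Q : ℝ → ℝ} {u v : X → ℝ} {g : X → ℂ}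
    (hp : Measurable (Function.uncurry p)) (hq : Measurable (Function.uncurry q))
    (hu : Measurable u) (hv : Measurable v)
    (hp0 : ∀ r s, 0 < s → 0 ≤ p r s) (hq0 : ∀ r s, 0 < s → 0 ≤ q r s)
    (hpint : ∀ r, 0 < r → IntegrableOn (p r) (Set.Ioi 0))
    (hqint : ∀ r, 0 < r → IntegrableOn (q r) (Set.Ioi 0))
    (hP : ∀ r, 0 < r → ∫ s in Set.Ioi 0, p r s = P r)
    (hQ : ∀ r, 0 < r → ∫ s in Set.Ioi 0, q r s = Q r)
    (hu0 : ∀ᵐ x ∂μ, 0 < u x) (hv0 : ∀ᵐ x ∂μ, 0 < v x)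
    (hg : AEStronglyMeasurable g μ)
    (hint : Integrable (fun x => ((P (u x) * Q (v x) : ℝ) : ℂ) * g x) μ) :
    ∫ x, ((P (u x) * Q (v x) : ℝ) : ℂ) * g x ∂μ =
      ∫ t in Set.Ioi (0 : ℝ) ×ˢ Set.Ioi (0 : ℝ),
        ∫ x, ((p (u x) t.1 * q (v x) t.2 : ℝ) : ℂ) * g x ∂μ := by
  have hν : (volume : Measure (ℝ × ℝ)).restrict (Set.Ioi (0 : ℝ) ×ˢ Set.Ioi (0 : ℝ)) =
      (volume.restrict (Set.Ioi (0 : ℝ))).prod (volume.restrict (Set.Ioi (0 : ℝ))) := by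
    rw [Measure.prod_restrict]
    rfl
  refine integral_ofReal_mul_eq_integral_integral
    (κ := fun z : X × (ℝ × ℝ) => p (u z.1) z.2.1 * q (v z.1) z.2.2) ?_ (fun x => ?_) ?_ ?_ hg hint
  · exact (hp.comp ((hu.comp measurable_fst).prodMk (measurable_fst.comp measurable_snd))).mul
      (hq.comp ((hv.comp measurable_fst).prodMk (measurable_snd.comp measurable_snd)))
  · filter_upwards [ae_restrict_mem (measurableSet_Ioi.prod measurableSet_Ioi)] with t ht
    exact mul_nonneg (hp0 _ _ ht.1) (hq0 _ _ ht.2)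
  · filter_upwards [hu0, hv0] with x hux hvx
    rw [hν]
    exact Integrable.mul_prod (hpint _ hux) (hqint _ hvx)
  · filter_upwards [hu0, hv0] with x hux hvx
    rw [hν, integral_prod_mul, hP _ hux, hQ _ hvx]

lemma ae_norm_sub_pos [Nontrivial V] (e : V) : ∀ᵐ w : V, 0 < ‖w - e‖ := by
  filter_upwards [Measure.ae_ne volume e] with w hw
  exact norm_pos_iff.2 (sub_ne_zero.2 hw)

theorem integral_kernel_mul_fourier [Nontrivial V] {e : V} (he : ‖e‖ = 1) {d₁ d₃ C : ℝ}
    (h₁ : d₁ ∈ Set.Ioo 0 (finrank ℝ V : ℝ)) (h₃ : d₃ ∈ Set.Ioo 0 (finrank ℝ V : ℝ))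
    (h₁₃ : finrank ℝ V < d₁ + d₃) {φ : V → ℂ} (hφ : Integrable φ) (hC : ∀ x, ‖φ x‖ ≤ C)
    (hφ' : Integrable fun w => ∫ x, phase w x * φ x) :
    Integrable (fun w => ((⟪w, e⟫ / (‖w‖ ^ (finrank ℝ V - d₃ + 1) *
      ‖w - e‖ ^ (finrank ℝ V - d₁)) : ℝ) : ℂ) * ∫ x, phase w x * φ x) ∧
    ∫ w, ((⟪w, e⟫ / (‖w‖ ^ (finrank ℝ V - d₃ + 1) *
      ‖w - e‖ ^ (finrank ℝ V - d₁)) : ℝ) : ℂ) * ∫ x, phase w x * φ x =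
    (↑(cLL d₁ * cLL (d₃ + 1)) : ℂ) /
      (Complex.I * (↑(cLL (finrank ℝ V - d₁) * cLL (finrank ℝ V - d₃ + 1)) : ℂ)) *
      ∫ ξ, (∫ y, ((⟪ξ - y, e⟫ / ‖ξ - y‖ ^ (d₃ + 1) : ℝ) : ℂ) *
        (phase y e / (‖y‖ ^ d₁ : ℝ))) * φ ξ := by
  obtain ⟨h₁0, h₁n⟩ := h₁
  obtain ⟨h₃0, h₃n⟩ := h₃
  set n : ℝ := Nat.cast (finrank ℝ V) with hn
  have hI := integrable_inner_div_mul he (a := n - d₃) (b := n - d₁) (by linarith) (by linarith)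
    (by linarith) hφ' (C := ∫ x, ‖φ x‖) fun w => by
      refine (norm_integral_le_integral_norm _).trans_eq ?_
      simp only [norm_mul, norm_phase, one_mul]
  have hJ := integrable_riesz_kernel_mul he ⟨h₁0, h₁n⟩ ⟨h₃0, h₃n⟩ h₁₃ hφ hC
  refine ⟨hI, ?_⟩
  have hp : ∀ c : ℝ, Measurable (Function.uncurry
      fun r s : ℝ => s ^ (c / 2 - 1) * exp (-(π * s * r ^ 2))) := fun c => by
    unfold Function.uncurry; fun_prop
  have hq : ∀ c : ℝ, Measurable (Function.uncurry
      fun r s : ℝ => s ^ (-(c / 2) - 1) * exp (-(π * r ^ 2 / s))) := fun c => by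
    unfold Function.uncurry; fun_prop
  have hc₁ := cLL_pos (μ := n - d₁) (by linarith)
  have hc₃ := cLL_pos (μ := n - d₃ + 1) (by linarith)
  have eL : ∀ w : V, ((cLL (n - d₃ + 1) * ‖w‖ ^ (-(n - d₃ + 1)) *
      (cLL (n - d₁) * ‖w - e‖ ^ (-(n - d₁))) : ℝ) : ℂ) * (⟪w, e⟫ * ∫ x, phase w x * φ x) =
      (cLL (n - d₁) * cLL (n - d₃ + 1) : ℝ) * (((⟪w, e⟫ / (‖w‖ ^ (n - d₃ + 1) *
      ‖w - e‖ ^ (n - d₁)) : ℝ) : ℂ) * ∫ x, phase w x * φ x) := by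
    intro w
    rw [rpow_neg (norm_nonneg _), rpow_neg (norm_nonneg _), div_eq_mul_inv, mul_inv]
    push_cast
    ring
  have eR : ∀ p : V × V, ((cLL (d₃ + 1) * ‖p.1 - p.2‖ ^ (-(d₃ + 1)) *
      (cLL d₁ * ‖p.2‖ ^ (-d₁)) : ℝ) : ℂ) * (-Complex.I * ⟪p.1 - p.2, e⟫ * (phase p.2 e * φ p.1)) =
      (-Complex.I * (cLL d₁ * cLL (d₃ + 1) : ℝ)) *
        (((⟪p.1 - p.2, e⟫ / ‖p.1 - p.2‖ ^ (d₃ + 1) : ℝ) : ℂ) *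
          (phase p.2 e / (‖p.2‖ ^ d₁ : ℝ)) * φ p.1) := by
    intro p
    rw [rpow_neg (norm_nonneg _), rpow_neg (norm_nonneg _), div_eq_mul_inv, div_eq_mul_inv]
    push_cast
    ring
  have L := integral_ofReal_mul_eq_integral_integral_of_mul (μ := (volume : Measure V))
    (P := fun r => cLL (n - d₃ + 1) * r ^ (-(n - d₃ + 1)))
    (Q := fun r => cLL (n - d₁) * r ^ (-(n - d₁)))
    (u := fun w => ‖w‖) (v := fun w => ‖w - e‖) (g := fun w => ⟪w, e⟫ * ∫ x, phase w x * φ x)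
    (hp (n - d₃ + 1)) (hp (n - d₁)) (by fun_prop) (by fun_prop)
    (fun r s hs => by positivity) (fun r s hs => by positivity)
    (fun r => integrableOn_rpow_mul_exp_neg_pi_mul (by linarith))
    (fun r => integrableOn_rpow_mul_exp_neg_pi_mul (by linarith))
    (fun r => integral_rpow_mul_exp_neg_pi_mul (by linarith))
    (fun r => integral_rpow_mul_exp_neg_pi_mul (by linarith))
    (by simpa using ae_norm_sub_pos (0 : V)) (ae_norm_sub_pos e)
    (AEStronglyMeasurable.mul (Measurable.aestronglyMeasurable (by fun_prop)) hφ'.1)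
    (by simp only [eL]; exact hI.const_mul _)
  have R := integral_ofReal_mul_eq_integral_integral_of_mul
    (μ := (volume.prod volume : Measure (V × V)))
    (P := fun r => cLL (d₃ + 1) * r ^ (-(d₃ + 1))) (Q := fun r => cLL d₁ * r ^ (-d₁))
    (u := fun p => ‖p.1 - p.2‖) (v := fun p => ‖p.2‖)
    (g := fun p => -Complex.I * ⟪p.1 - p.2, e⟫ * (phase p.2 e * φ p.1))
    (hq (d₃ + 1)) (hq d₁) (by fun_prop) (by fun_prop)
    (fun r s hs => by positivity) (fun r s hs => by positivity)
    (fun r => integrableOn_rpow_mul_exp_neg_pi_div (by linarith))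
    (fun r => integrableOn_rpow_mul_exp_neg_pi_div (by linarith))
    (fun r => integral_rpow_mul_exp_neg_pi_div (by linarith))
    (fun r => integral_rpow_mul_exp_neg_pi_div (by linarith))
    (by
      have h := (measurePreserving_sub_prod (volume : Measure V) volume).quasiMeasurePreserving.ae
        (Measure.quasiMeasurePreserving_fst.ae (ae_norm_sub_pos (0 : V)))
      simpa using h)
    (by simpa using Measure.quasiMeasurePreserving_snd.ae (ae_norm_sub_pos (0 : V)))
    (AEStronglyMeasurable.mul (Measurable.aestronglyMeasurable (by fun_prop))
      (AEStronglyMeasurable.mul (by unfold phase; fun_prop) hφ.1.comp_fst))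
    (by simp only [eR]; exact hJ.const_mul _)
  simp only [eL] at L
  simp only [eR] at R
  rw [integral_const_mul] at L R
  have key : ∀ t ∈ Set.Ioi (0 : ℝ) ×ˢ Set.Ioi (0 : ℝ),
      ∫ w : V, ((t.1 ^ ((n - d₃ + 1) / 2 - 1) * exp (-(π * t.1 * ‖w‖ ^ 2)) *
        (t.2 ^ ((n - d₁) / 2 - 1) * exp (-(π * t.2 * ‖w - e‖ ^ 2))) : ℝ) : ℂ) *
        (⟪w, e⟫ * ∫ x, phase w x * φ x) =
      ∫ p : V × V, ((t.1 ^ (-((d₃ + 1) / 2) - 1) * exp (-(π * ‖p.1 - p.2‖ ^ 2 / t.1)) *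
        (t.2 ^ (-(d₁ / 2) - 1) * exp (-(π * ‖p.2‖ ^ 2 / t.2))) : ℝ) : ℂ) *
        (-Complex.I * ⟪p.1 - p.2, e⟫ * (phase p.2 e * φ p.1)) := by
    rintro ⟨s, t⟩ ⟨hs, ht⟩
    simp only [Set.mem_Ioi] at hs ht
    have h := congrArg (fun z => ((s ^ ((n - d₃ + 1) / 2 - 1) * t ^ ((n - d₁) / 2 - 1) : ℝ) : ℂ) * z)
      (integral_gaussian_mul_gaussian_mul_fourier hs ht e hφ)
    beta_reduce at h
    rw [← integral_const_mul, ← integral_const_mul] at h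
    have es : s ^ (-((d₃ + 1) / 2) - 1) = s ^ ((n - d₃ + 1) / 2 - 1) * s ^ (-(n / 2) - 1) := by
      rw [← rpow_add hs]; ring_nf
    have et : t ^ (-(d₁ / 2) - 1) = t ^ ((n - d₁) / 2 - 1) * t ^ (-(n / 2)) := by
      rw [← rpow_add ht]; ring_nf
    convert h using 1
    · congr 1 with w
      push_cast
      ring
    · congr 1 with p
      rw [es, et]
      push_cast
      ring
  rw [setIntegral_congr_fun (measurableSet_Ioi.prod measurableSet_Ioi) key,
    Measure.volume_eq_prod V V, ← R, integral_prod _ hJ] at L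
  simp only [integral_mul_const] at L
  have hc : ((cLL (n - d₁) * cLL (n - d₃ + 1) : ℝ) : ℂ) ≠ 0 := by
    exact_mod_cast (mul_pos hc₁ hc₃).ne'
  apply mul_left_cancel₀ hc
  rw [L, ← mul_assoc]
  congr 1
  field_simp
  rw [Complex.I_sq]
  ring

end Fourier

/-- **Proposition A.4**: the distributional Fourier–convolution identity, tested against
an arbitrary complex-valued Schwartz function `φ` (with Fourier transform
`φ̂(w) = ∫ e^{−2πi w·x} φ(x) dx`). -/
theorem fourier_convolution_identity
    (d : ℕ) (hd : 2 ≤ d)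
    (d₁ d₃ : ℝ) (h₁ : d₁ ∈ Set.Ioo (0:ℝ) (d:ℝ)) (h₃ : d₃ ∈ Set.Ioo (0:ℝ) (d:ℝ))
    (h₁₃ : (d:ℝ) < d₁ + d₃)
    (e₁ : Euc d) (he₁ : e₁ = EuclideanSpace.single (⟨0, by omega⟩ : Fin d) (1:ℝ))
    (φ : SchwartzMap (Euc d) ℂ) :
    Integrable (fun w : Euc d =>
        (↑(⟪w, e₁⟫ / (‖w‖ ^ ((d:ℝ) - d₃ + 1) * ‖w - e₁‖ ^ ((d:ℝ) - d₁))) : ℂ) *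
          ∫ x : Euc d, Complex.exp ((↑(-(2 * Real.pi * ⟪w, x⟫)) : ℂ) * Complex.I) * φ x) ∧
    Integrable (fun ξ : Euc d =>
        (∫ y : Euc d,
            (↑(⟪ξ - y, e₁⟫ / ‖ξ - y‖ ^ (d₃ + 1)) : ℂ) *
              (Complex.exp ((↑(-(2 * Real.pi * ⟪y, e₁⟫)) : ℂ) * Complex.I) /
                (↑(‖y‖ ^ d₁) : ℂ))) * φ ξ) ∧
    (∫ w : Euc d,
        (↑(⟪w, e₁⟫ / (‖w‖ ^ ((d:ℝ) - d₃ + 1) * ‖w - e₁‖ ^ ((d:ℝ) - d₁))) : ℂ) *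
          ∫ x : Euc d, Complex.exp ((↑(-(2 * Real.pi * ⟪w, x⟫)) : ℂ) * Complex.I) * φ x)
      = (↑(cLL d₁ * cLL (d₃ + 1)) : ℂ) /
          (Complex.I * (↑(cLL ((d:ℝ) - d₁) * cLL ((d:ℝ) - d₃ + 1)) : ℂ)) *
        ∫ ξ : Euc d,
          (∫ y : Euc d,
              (↑(⟪ξ - y, e₁⟫ / ‖ξ - y‖ ^ (d₃ + 1)) : ℂ) *
                (Complex.exp ((↑(-(2 * Real.pi * ⟪y, e₁⟫)) : ℂ) * Complex.I) /
                  (↑(‖y‖ ^ d₁) : ℂ))) * φ ξ := by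
  have hn : (Module.finrank ℝ (Euc d) : ℝ) = d := by simp
  have : Nontrivial (Euc d) :=
    Module.nontrivial_of_finrank_pos (R := ℝ) (by rw [finrank_euclideanSpace_fin]; omega)
  have he : ‖e₁‖ = 1 := by simp [he₁]
  have hC := φ.norm_le_seminorm ℝ
  rw [← hn] at h₁ h₃ h₁₃ ⊢
  have hφ' : Integrable fun w : Euc d => ∫ x, phase w x * φ x := by
    refine (FourierTransform.fourier φ).integrable.congr (ae_of_all _ fun w => ?_)
    simp only [SchwartzMap.fourier_coe, Real.fourier_eq', phase, smul_eq_mul]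
    congr 1 with x
    rw [real_inner_comm]
    ring_nf
  obtain ⟨hI, hEq⟩ := integral_kernel_mul_fourier he h₁ h₃ h₁₃ φ.integrable hC hφ'
  refine ⟨hI, ?_, hEq⟩
  have hJ := (integrable_riesz_kernel_mul he h₁ h₃ h₁₃ φ.integrable hC).integral_prod_left
  simp only [integral_mul_const] at hJ
  exact hJ
end
end
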